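/- Let α, β ∈ (0,1). For c > 0 set γ̂ = (2c − √(4c² + 16α))/8 and I_sph(c,α) = γ̂ − (α/(2c))·log(1 − c/(2γ̂)). For c > 0, γ > c/2 and ν₁, ν₂ ≥ 0, let h be a standard normal random variable, let t⁺(h) = max( (h − ν₁)²/(4γ) − ν₂ , (max(h − ν₁, 0))²/(4γ) + ν₂ ), I⁺(c,γ,ν₁,ν₂) = E[ exp(c·t⁺(h)) ], and I_str⁺(c,β) = inf_{γ > c/2, ν₁ ≥ 0, ν₂ ≥ 0} ( ν₂(2β − 1) + γ + (1/c)·log I⁺(c,γ,ν₁,ν₂) ). Assume there exists c > 0 with −c/2 + I_str⁺(c,β) + I_sph(c,α) < 0. Then there exists ε > 0 such that for all sufficiently large n, with m = ⌈αn⌉, k = ⌈βn⌉, and A an m×n random matrix with i.i.d. standard normal entries, the probability is at least 1 − e^{−εn} that every x ∈ ℝ^n with x_i ≥ 0 for all i and at most k nonzero entries is the unique solution of the optimization problem: minimize ‖z‖₁ subject to Az = Ax and z_i ≥ 0 for all i. -/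

import Mathlib

open MeasureTheory ProbabilityTheory

/-- The spherical exponent `I_sph(c,α) = γ̂ − (α/(2c))·log(1 − c/(2γ̂))` with
`γ̂ = (2c − √(4c² + 16α))/8`. -/
noncomputable def Isph (c α : ℝ) : ℝ :=
  (2 * c - Real.sqrt (4 * c ^ 2 + 16 * α)) / 8 -
    (α / (2 * c)) * Real.log
      (1 - c / (2 * ((2 * c - Real.sqrt (4 * c ^ 2 + 16 * α)) / 8)))

/-- `I⁺(c,γ,ν₁,ν₂) = E[exp(c·t⁺(h))]` for a standard normal `h`, where
`t⁺(h) = max((h−ν₁)²/(4γ) − ν₂, (max(h−ν₁,0))²/(4γ) + ν₂)`. -/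
noncomputable def IexpPlus (c γ ν₁ ν₂ : ℝ) : ℝ :=
  ∫ x : ℝ, Real.exp (c * max ((x - ν₁) ^ 2 / (4 * γ) - ν₂)
      ((max (x - ν₁) 0) ^ 2 / (4 * γ) + ν₂)) ∂(gaussianReal 0 1)

/-- `I_str⁺(c,β)`: infimum over `γ > c/2`, `ν₁ ≥ 0`, `ν₂ ≥ 0`. -/
noncomputable def IstrPlus (c β : ℝ) : ℝ :=
  sInf {v : ℝ | ∃ γ ν₁ ν₂ : ℝ, c / 2 < γ ∧ 0 ≤ ν₁ ∧ 0 ≤ ν₂ ∧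
    v = ν₂ * (2 * β - 1) + γ + (1 / c) * Real.log (IexpPlus c γ ν₁ ν₂)}

/-- `x` is the unique minimizer of `‖z‖₁` subject to `Az = Ax` and `z ≥ 0`. -/
def UniqueL1MinNonneg {m n : ℕ} (A : Fin m → Fin n → ℝ) (x : Fin n → ℝ) : Prop :=
  ∀ z : Fin n → ℝ, (∀ i, ∑ j, A i j * z j = ∑ j, A i j * x j) → (∀ i, 0 ≤ z i) →
    z ≠ x → ∑ i, |x i| < ∑ i, |z i|

/-- The law of an `m × n` matrix with i.i.d. standard normal entries. -/
noncomputable def matrixGaussian (m n : ℕ) : Measure (Fin m → Fin n → ℝ) :=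
  Measure.pi fun _ => Measure.pi fun _ => gaussianReal 0 1

open MeasureTheory ProbabilityTheory

namespace GI

noncomputable abbrev g1 : Measure ℝ := gaussianReal 0 1

lemma integrable_exp_abs (C : ℝ) : Integrable (fun x : ℝ => Real.exp (C * |x|)) g1 := by
  have h1 : Integrable (fun x : ℝ => Real.exp (C * x)) g1 := integrable_exp_mul_gaussianReal C
  have h2 : Integrable (fun x : ℝ => Real.exp ((-C) * x)) g1 := integrable_exp_mul_gaussianReal (-C)
  refine (h1.add h2).mono' (by fun_prop) (Filter.Eventually.of_forall fun x => ?_)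
  rw [Real.norm_eq_abs, abs_of_pos (Real.exp_pos _)]
  simp only [Pi.add_apply]
  rcases abs_cases x with ⟨h, _⟩ | ⟨h, _⟩ <;> rw [h]
  · have := Real.exp_pos (-C * x); linarith
  · have := Real.exp_pos (C * x)
    have e : C * -x = -C * x := by ring
    rw [e]; linarith

lemma integrable_g1_iff {f : ℝ → ℝ} :
    Integrable f g1 ↔ Integrable (fun x => gaussianPDFReal 0 1 x * f x) := by
  unfold g1
  rw [gaussianReal_of_var_ne_zero _ (one_ne_zero),
    integrable_withDensity_iff_integrable_smul₀' (by fun_prop)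
      (Filter.Eventually.of_forall fun x => gaussianPDF_lt_top)]
  simp [toReal_gaussianPDF]

lemma stein1 {f f' : ℝ → ℝ} (hf : ∀ x, HasDerivAt f (f' x) x) 
    (h1 : Integrable f g1) (h2 : Integrable f' g1) (h3 : Integrable (fun x => x * f x) g1) :
    ∫ x, x * f x ∂g1 = ∫ x, f' x ∂g1 := by
  have hp : ∀ x, HasDerivAt (gaussianPDFReal 0 1) (-x * gaussianPDFReal 0 1 x) x := by
    intro x
    simp only [gaussianPDFReal_def]
    have h : HasDerivAt (fun x : ℝ => -(x - 0) ^ 2 / (2 * ((1 : NNReal) : ℝ))) (-x) x := by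
      have := (((hasDerivAt_id x).sub_const 0).pow 2).neg.div_const (2 * ((1 : NNReal) : ℝ))
      refine this.congr_deriv ?_
      simp
      ring
    have := (h.exp).const_mul ((Real.sqrt (2 * Real.pi * ((1 : NNReal) : ℝ)))⁻¹)
    refine this.congr_deriv ?_
    ring
  rw [integrable_g1_iff] at h1 h2 h3
  have key := integral_mul_deriv_eq_deriv_mul_of_integrable
    (u := f) (u' := f') (v := gaussianPDFReal 0 1) (v' := fun x => -x * gaussianPDFReal 0 1 x)
    (fun x _ => hf x) (fun x _ => hp x)
    (by refine h3.neg.congr (Filter.Eventually.of_forall fun x => ?_)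
        simp; ring)
    (by refine h2.congr (Filter.Eventually.of_forall fun x => ?_)
        simp; ring)
    (by refine h1.congr (Filter.Eventually.of_forall fun x => ?_)
        simp; ring)
  rw [integral_gaussianReal_eq_integral_smul one_ne_zero,
    integral_gaussianReal_eq_integral_smul one_ne_zero]
  simp only [smul_eq_mul]
  have e1 : ∀ x, gaussianPDFReal 0 1 x * (x * f x) = - (f x * (-x * gaussianPDFReal 0 1 x)) := by
    intro x; ring
  simp_rw [e1]
  rw [integral_neg, key, neg_neg]
  congr 1; ext x; ring

variable {D : Type*} [Fintype D]

noncomputable abbrev gD (D : Type*) [Fintype D] : Measure (D → ℝ) := Measure.pi fun _ => g1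

lemma integrable_exp_norm (C : ℝ) : Integrable (fun x : D → ℝ => Real.exp (C * ‖x‖)) (gD D) := by
  have h : Integrable (fun x : D → ℝ => 1 + ∑ d, Real.exp (C * |x d|)) (gD D) := by
    refine (integrable_const _).add (integrable_finsetSum _ fun d _ => ?_)
    exact integrable_comp_eval (μ := fun _ : D => g1) (i := d) (integrable_exp_abs C)
  refine h.mono' (by fun_prop) (Filter.Eventually.of_forall fun x => ?_)
  rw [Real.norm_eq_abs, abs_of_pos (Real.exp_pos _)]
  rcases isEmpty_or_nonempty D with hD | hD
  · have : x = 0 := Subsingleton.elim _ _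
    simp [this]
  · obtain ⟨d, hd'⟩ := Finite.exists_max (fun d => |x d|)
    have hd : |x d| = ‖x‖ := le_antisymm (norm_le_pi_norm x d)
      ((pi_norm_le_iff_of_nonneg (abs_nonneg _)).2 hd')
    have : Real.exp (C * ‖x‖) ≤ ∑ d, Real.exp (C * |x d|) := by
      rw [← hd]
      exact Finset.single_le_sum (f := fun d => Real.exp (C * |x d|))
        (fun i _ => (Real.exp_pos _).le) (Finset.mem_univ d)
    linarith

/-- exponential growth -/
def Gr {E : Type*} [NormedAddCommGroup E] (f : E → ℝ) : Prop :=
  Continuous f ∧ ∃ C : ℝ, 0 ≤ C ∧ ∀ x, |f x| ≤ C * Real.exp (C * ‖x‖)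

lemma Gr.integrable {f : (D → ℝ) → ℝ} (h : Gr f) : Integrable f (gD D) := by
  obtain ⟨hc, C, _, hC⟩ := h
  exact ((integrable_exp_norm C).const_mul C).mono' hc.aestronglyMeasurable
    (Filter.Eventually.of_forall hC)

section
variable {E E' : Type*} [NormedAddCommGroup E] [NormedAddCommGroup E']

lemma Gr.add {f g : E → ℝ} (hf : Gr f) (hg : Gr g) : Gr (fun x => f x + g x) := by
  obtain ⟨c1, C, h0, hC⟩ := hf
  obtain ⟨c2, C', h0', hC'⟩ := hg
  refine ⟨c1.add c2, C + C', by positivity, fun x => ?_⟩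
  have hn := norm_nonneg x
  have e1 : Real.exp (C * ‖x‖) ≤ Real.exp ((C + C') * ‖x‖) := by gcongr; linarith
  have e2 : Real.exp (C' * ‖x‖) ≤ Real.exp ((C + C') * ‖x‖) := by gcongr; linarith
  calc |f x + g x| ≤ |f x| + |g x| := abs_add_le _ _
    _ ≤ C * Real.exp (C * ‖x‖) + C' * Real.exp (C' * ‖x‖) := add_le_add (hC x) (hC' x)
    _ ≤ C * Real.exp ((C + C') * ‖x‖) + C' * Real.exp ((C + C') * ‖x‖) := by gcongr
    _ = _ := by ring

lemma Gr.mul {f g : E → ℝ} (hf : Gr f) (hg : Gr g) : Gr (fun x => f x * g x) := by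
  obtain ⟨c1, C, h0, hC⟩ := hf
  obtain ⟨c2, C', h0', hC'⟩ := hg
  refine ⟨c1.mul c2, C * C' + C + C', by positivity, fun x => ?_⟩
  have hn := norm_nonneg x
  calc |f x * g x| = |f x| * |g x| := abs_mul _ _
    _ ≤ (C * Real.exp (C * ‖x‖)) * (C' * Real.exp (C' * ‖x‖)) :=
        mul_le_mul (hC x) (hC' x) (abs_nonneg _) (by positivity)
    _ = (C * C') * Real.exp ((C + C') * ‖x‖) := by rw [add_mul, Real.exp_add]; ring
    _ ≤ _ := by
      gcongr
      · nlinarith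
      · nlinarith [mul_nonneg h0 h0']

lemma Gr.const (c : ℝ) : Gr (fun _ : E => c) :=
  ⟨continuous_const, |c|, abs_nonneg _, fun x => by
    have : 1 ≤ Real.exp (|c| * ‖x‖) := Real.one_le_exp (by positivity)
    nlinarith [abs_nonneg c]⟩

lemma Gr.sum {ι : Type*} (s : Finset ι) {f : ι → E → ℝ} (h : ∀ i ∈ s, Gr (f i)) :
    Gr (fun x => ∑ i ∈ s, f i x) := by
  classical
  induction s using Finset.induction_on with
  | empty => simpa using Gr.const (E := E) 0
  | insert a s ha ih =>
    simp only [Finset.sum_insert ha]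
    exact (h a (by simp)).add (ih fun i hi => h i (by simp [hi]))

lemma Gr.of_le {f g : E → ℝ} (hc : Continuous f) (hg : Gr g) (h : ∀ x, |f x| ≤ |g x|) : Gr f :=
  ⟨hc, hg.2.imp fun _ hC => ⟨hC.1, fun x => (h x).trans (hC.2 x)⟩⟩

lemma Gr.norm : Gr (fun x : E => ‖x‖) :=
  ⟨continuous_norm, 1, zero_le_one, fun x => by
    have := Real.add_one_le_exp ‖x‖
    rw [abs_of_nonneg (norm_nonneg x)]; simp; linarith⟩

lemma Gr.exp_norm (C : ℝ) (hC : 0 ≤ C) : Gr (fun x : E => Real.exp (C * ‖x‖)) :=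
  ⟨by fun_prop, C + 1, by positivity, fun x => by
    have := norm_nonneg x
    rw [abs_of_pos (Real.exp_pos _)]
    calc Real.exp (C * ‖x‖) ≤ 1 * Real.exp ((C + 1) * ‖x‖) := by
          rw [one_mul]; gcongr; linarith
      _ ≤ _ := by gcongr; linarith⟩

lemma Gr.comp_lin [NormedSpace ℝ E] [NormedSpace ℝ E'] {f : E → ℝ} (hf : Gr f) (L : E' →L[ℝ] E) :
    Gr (fun x => f (L x)) := by
  obtain ⟨hc, C, h0, hC⟩ := hf
  refine ⟨hc.comp L.continuous, C + C * ‖L‖, by positivity, fun x => ?_⟩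
  have hn := norm_nonneg x
  have hL := L.le_opNorm x
  calc |f (L x)| ≤ C * Real.exp (C * ‖L x‖) := hC _
    _ ≤ C * Real.exp (C * (‖L‖ * ‖x‖)) := by gcongr
    _ ≤ (C + C * ‖L‖) * Real.exp ((C + C * ‖L‖) * ‖x‖) := by
      have h1 : 0 ≤ C * ‖L‖ := by positivity
      refine mul_le_mul (by linarith) (Real.exp_le_exp.2 ?_) (Real.exp_pos _).le (by linarith)
      nlinarith [mul_nonneg h0 hn]

end

lemma Gr.lin (L : (D → ℝ) →L[ℝ] ℝ) : Gr (fun x => L x) := by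
  refine Gr.of_le L.continuous ((Gr.const ‖L‖).mul Gr.norm) fun x => ?_
  rw [abs_of_nonneg (by positivity : 0 ≤ ‖L‖ * ‖x‖)]
  exact L.le_opNorm x

lemma mp_update [DecidableEq D] (d : D) :
    MeasurePreserving (fun p : (D → ℝ) × ℝ => Function.update p.1 d p.2) ((gD D).prod g1) (gD D) := by
  have hm : Measurable (fun p : (D → ℝ) × ℝ => Function.update p.1 d p.2) := by
    refine measurable_pi_lambda _ fun i => ?_
    by_cases h : i = d
    · subst h; simpa using measurable_snd
    · simpa [Function.update_of_ne h] using (by fun_prop : Measurable fun c : (D → ℝ) × ℝ => c.1 i)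
  refine ⟨hm, (Measure.pi_eq fun s hs => ?_).symm⟩
  rw [Measure.map_apply hm (MeasurableSet.univ_pi hs)]
  have : (fun p : (D → ℝ) × ℝ => Function.update p.1 d p.2) ⁻¹' (Set.univ.pi s)
      = (Set.univ.pi (Function.update s d Set.univ)) ×ˢ (s d) := by
    ext ⟨x, y⟩
    simp only [Set.mem_preimage, Set.mem_univ_pi, Set.mem_prod]
    constructor
    · intro h
      refine ⟨fun i => ?_, by simpa using h d⟩
      by_cases hi : i = d
      · subst hi; simp
      · simpa [Function.update_of_ne hi] using h i
    · rintro ⟨h, h'⟩ i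
      by_cases hi : i = d
      · subst hi; simpa using h'
      · simpa [Function.update_of_ne hi] using h i
  rw [this, Measure.prod_prod, Measure.pi_pi, ← Finset.mul_prod_erase _ _ (Finset.mem_univ d),
    ← Finset.mul_prod_erase _ _ (Finset.mem_univ d)]
  simp only [Function.update_self, measure_univ, one_mul]
  rw [mul_comm]
  congr 1
  refine Finset.prod_congr rfl fun i hi => ?_
  rw [Function.update_of_ne (Finset.ne_of_mem_erase hi)]

lemma steinD [DecidableEq D] (d : D) {f f' : (D → ℝ) → ℝ}
    (hf : ∀ x s, HasDerivAt (fun s => f (Function.update x d s)) (f' (Function.update x d s)) s)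
    (h1 : Gr f) (h2 : Gr f') :
    ∫ x, x d * f x ∂(gD D) = ∫ x, f' x ∂(gD D) := by
  have hl : Gr (fun x : D → ℝ => x d) := Gr.lin (ContinuousLinearMap.proj d)
  have h3 := hl.mul h1
  have mp := mp_update d
  have i1 := mp.integrable_comp_of_integrable h1.integrable
  have i2 := mp.integrable_comp_of_integrable h2.integrable
  have i3 := mp.integrable_comp_of_integrable h3.integrable
  simp only [Function.comp_def] at i1 i2 i3
  have e3 : ∀ {h : (D → ℝ) → ℝ}, Gr h →
      ∫ x, h x ∂(gD D) = ∫ p, h (Function.update p.1 d p.2) ∂((gD D).prod g1) := by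
    intro h hh
    have := integral_map (μ := (gD D).prod g1) (f := h) mp.measurable.aemeasurable
      (by rw [mp.map_eq]; exact hh.integrable.aestronglyMeasurable)
    rwa [mp.map_eq] at this
  rw [e3 h3, e3 h2, integral_prod _ i3, integral_prod _ i2]
  refine integral_congr_ae ?_
  filter_upwards [i1.prod_right_ae, i2.prod_right_ae, i3.prod_right_ae] with x j1 j2 j3
  simp only [Function.update_self] at *
  exact stein1 (hf x) j1 j2 j3

end GI

open MeasureTheory ProbabilityTheory
namespace GI

set_option linter.unusedSectionVars false
variable {D I : Type*} [Fintype D] [Fintype I]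

noncomputable def lin (P : I → D → ℝ) : (D → ℝ) →L[ℝ] (I → ℝ) :=
  ContinuousLinearMap.pi fun a => ∑ d, P a d • ContinuousLinearMap.proj d

lemma lin_apply (P : I → D → ℝ) (x : D → ℝ) (a : I) : lin P x a = ∑ d, P a d * x d := by
  simp [lin]

lemma lin_update [DecidableEq D] (P : I → D → ℝ) (x : D → ℝ) (d : D) (s : ℝ) :
    HasDerivAt (fun s => lin P (Function.update x d s)) (fun a => P a d) s := by
  rw [hasDerivAt_pi]
  intro a
  simp only [lin_apply]
  have h : ∀ s, ∑ i, P a i * Function.update x d s i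
      = P a d * s + ∑ i ∈ Finset.univ.erase d, P a i * x i := by
    intro s
    rw [← Finset.add_sum_erase _ _ (Finset.mem_univ d)]
    simp only [Function.update_self]
    congr 1
    refine Finset.sum_congr rfl fun i hi => ?_
    rw [Function.update_of_ne (Finset.ne_of_mem_erase hi)]
  simp_rw [h]
  exact (((hasDerivAt_id s).const_mul (P a d)).add_const
    (∑ i ∈ Finset.univ.erase d, P a i * x i)).congr_deriv (by simp)

variable {F : (I → ℝ) → ℝ} {F1 : I → (I → ℝ) → ℝ} {F2 : I → I → (I → ℝ) → ℝ}

lemma ibp (L M : I → D → ℝ)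
    (hF1 : ∀ a z, HasFDerivAt (F1 a)
      (∑ b, F2 a b z • (ContinuousLinearMap.proj b : (I → ℝ) →L[ℝ] ℝ)) z)
    (g1 : ∀ a, Gr (F1 a)) (g2 : ∀ a b, Gr (F2 a b)) :
    ∫ x, ∑ a, F1 a (lin L x) * lin M x a ∂(gD D)
      = ∫ x, ∑ a, ∑ b, (∑ d, M a d * L b d) * F2 a b (lin L x) ∂(gD D) := by
  classical
  have hl : ∀ d, Gr (fun x : D → ℝ => x d) := fun d => Gr.lin (ContinuousLinearMap.proj d)
  have e : ∀ x, ∑ a, F1 a (lin L x) * lin M x a = ∑ a, ∑ d, M a d * (x d * F1 a (lin L x)) := by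
    intro x
    refine Finset.sum_congr rfl fun a _ => ?_
    rw [lin_apply, Finset.mul_sum]
    refine Finset.sum_congr rfl fun d _ => by ring
  have i1 : ∀ a d, Gr fun x : D → ℝ => M a d * (x d * F1 a (lin L x)) := fun a d =>
    (Gr.const _).mul ((hl d).mul ((g1 a).comp_lin _))
  have i2 : ∀ a b d, Gr fun x : D → ℝ => L b d * F2 a b (lin L x) := fun a b d =>
    (Gr.const _).mul ((g2 a b).comp_lin _)
  have i3 : ∀ a b, Gr fun x : D → ℝ => (∑ d, M a d * L b d) * F2 a b (lin L x) := fun a b =>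
    (Gr.const _).mul ((g2 a b).comp_lin _)
  simp_rw [e]
  rw [integral_finsetSum _ fun a _ => (Gr.sum _ fun d _ => i1 a d).integrable,
    integral_finsetSum _ fun a _ => (Gr.sum _ fun b _ => i3 a b).integrable]
  refine Finset.sum_congr rfl fun a _ => ?_
  rw [integral_finsetSum _ fun d _ => (i1 a d).integrable,
    integral_finsetSum _ fun b _ => (i3 a b).integrable]
  have st : ∀ d, ∫ x, x d * F1 a (lin L x) ∂(gD D)
      = ∫ x, ∑ b, L b d * F2 a b (lin L x) ∂(gD D) := by
    intro d
    refine steinD d (f := fun x => F1 a (lin L x)) ?_ ((g1 a).comp_lin _)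
      (Gr.sum _ fun b _ => i2 a b d)
    intro x s
    have := (hF1 a (lin L (Function.update x d s))).comp_hasDerivAt s (lin_update L x d s)
    refine this.congr_deriv ?_
    simp [mul_comm]
  simp_rw [integral_const_mul, st]
  have st2 : ∀ d, ∫ x, ∑ b, L b d * F2 a b (lin L x) ∂(gD D)
      = ∑ b, L b d * ∫ x, F2 a b (lin L x) ∂(gD D) := by
    intro d
    rw [integral_finsetSum _ fun b _ => (i2 a b d).integrable]
    simp_rw [integral_const_mul]
  simp_rw [st2, Finset.mul_sum, Finset.sum_mul]
  rw [Finset.sum_comm]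
  refine Finset.sum_congr rfl fun b _ => Finset.sum_congr rfl fun d _ => by ring

theorem interp (P Q : I → D → ℝ)
    (hF : ∀ z, HasFDerivAt F
      (∑ a, F1 a z • (ContinuousLinearMap.proj a : (I → ℝ) →L[ℝ] ℝ)) z)
    (hF1 : ∀ a z, HasFDerivAt (F1 a)
      (∑ b, F2 a b z • (ContinuousLinearMap.proj b : (I → ℝ) →L[ℝ] ℝ)) z)
    (g0 : Gr F) (g1 : ∀ a, Gr (F1 a)) (g2 : ∀ a b, Gr (F2 a b))
    (horth : ∀ a b, ∑ d, P a d * Q b d = 0)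
    (hneg : ∀ z, ∑ a, ∑ b, (∑ d, (P a d * P b d - Q a d * Q b d)) * F2 a b z ≤ 0) :
    ∫ x, F (lin P x) ∂(gD D) ≤ ∫ x, F (lin Q x) ∂(gD D) := by
  let Z : ℝ → I → D → ℝ := fun t a d => Real.sin t * P a d + Real.cos t * Q a d
  let Z' : ℝ → I → D → ℝ := fun t a d => Real.cos t * P a d - Real.sin t * Q a d
  have hZ : ∀ t x, lin (Z t) x = Real.sin t • lin P x + Real.cos t • lin Q x := by
    intro t x; ext a
    simp only [lin_apply, Z, Pi.add_apply, Pi.smul_apply, smul_eq_mul, Finset.mul_sum,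
      ← Finset.sum_add_distrib]
    exact Finset.sum_congr rfl fun d _ => by ring
  have hZ' : ∀ t x, lin (Z' t) x = Real.cos t • lin P x - Real.sin t • lin Q x := by
    intro t x; ext a
    simp only [lin_apply, Z', Pi.sub_apply, Pi.smul_apply, smul_eq_mul, Finset.mul_sum,
      ← Finset.sum_sub_distrib]
    exact Finset.sum_congr rfl fun d _ => by ring
  have hd : ∀ t x, HasDerivAt (fun t => F (lin (Z t) x))
      (∑ a, F1 a (lin (Z t) x) * lin (Z' t) x a) t := by
    intro t x
    have h1 : HasDerivAt (fun t => lin (Z t) x) (lin (Z' t) x) t := by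
      simp_rw [hZ, hZ']
      have := ((Real.hasDerivAt_sin t).smul_const (lin P x)).add
        ((Real.hasDerivAt_cos t).smul_const (lin Q x))
      refine this.congr_deriv ?_
      rw [neg_smul, sub_eq_add_neg]
    refine ((hF (lin (Z t) x)).comp_hasDerivAt t h1).congr_deriv ?_
    simp
  set K : ℝ := ‖lin P‖ + ‖lin Q‖ with hK
  have hK0 : 0 ≤ K := by positivity
  have bZ : ∀ t x, ‖lin (Z t) x‖ ≤ K * ‖x‖ := by
    intro t x
    rw [hZ]
    refine (norm_add_le _ _).trans ?_
    rw [norm_smul, norm_smul, hK, add_mul, Real.norm_eq_abs, Real.norm_eq_abs]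
    have a1 := Real.abs_sin_le_one t
    have a2 := Real.abs_cos_le_one t
    refine add_le_add ?_ ?_
    · exact (mul_le_of_le_one_left (norm_nonneg _) a1).trans ((lin P).le_opNorm x)
    · exact (mul_le_of_le_one_left (norm_nonneg _) a2).trans ((lin Q).le_opNorm x)
  have bZ' : ∀ t x, ‖lin (Z' t) x‖ ≤ K * ‖x‖ := by
    intro t x
    rw [hZ']
    refine (norm_sub_le _ _).trans ?_
    rw [norm_smul, norm_smul, hK, add_mul, Real.norm_eq_abs, Real.norm_eq_abs]
    have a1 := Real.abs_sin_le_one t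
    have a2 := Real.abs_cos_le_one t
    refine add_le_add ?_ ?_
    · exact (mul_le_of_le_one_left (norm_nonneg _) a2).trans ((lin P).le_opNorm x)
    · exact (mul_le_of_le_one_left (norm_nonneg _) a1).trans ((lin Q).le_opNorm x)
  choose C hC0 hC using fun a => (g1 a).2
  have gb : Gr (fun x : D → ℝ => ∑ a, C a * Real.exp (C a * K * ‖x‖) * (K * ‖x‖)) := by
    refine Gr.sum _ fun a _ => ((Gr.const _).mul (Gr.exp_norm _ (mul_nonneg (hC0 a) hK0))).mul
      ((Gr.const _).mul Gr.norm)
  have gd : ∀ t, Gr (fun x : D → ℝ => ∑ a, F1 a (lin (Z t) x) * lin (Z' t) x a) := fun t =>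
    Gr.sum _ fun a _ => ((g1 a).comp_lin _).mul
      (Gr.lin ((ContinuousLinearMap.proj a).comp (lin (Z' t))))
  have key : ∀ t, HasDerivAt (fun t => ∫ x, F (lin (Z t) x) ∂(gD D))
      (∫ x, ∑ a, F1 a (lin (Z t) x) * lin (Z' t) x a ∂(gD D)) t := by
    intro t
    refine (hasDerivAt_integral_of_dominated_loc_of_deriv_le (s := Set.univ) Filter.univ_mem
      (Filter.Eventually.of_forall fun t => ((g0.comp_lin _).integrable).aestronglyMeasurable)
      (g0.comp_lin _).integrable (gd t).integrable.aestronglyMeasurable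
      (Filter.Eventually.of_forall fun x t _ => ?_) gb.integrable
      (Filter.Eventually.of_forall fun x t _ => hd t x)).2
    refine (norm_sum_le _ _).trans (Finset.sum_le_sum fun a _ => ?_)
    rw [norm_mul]
    refine mul_le_mul ((hC a _).trans ?_) ((norm_le_pi_norm _ a).trans (bZ' t x)) (norm_nonneg _)
      (mul_nonneg (hC0 a) (Real.exp_pos _).le)
    refine mul_le_mul_of_nonneg_left (Real.exp_le_exp.2 ?_) (hC0 a)
    rw [mul_assoc]
    exact mul_le_mul_of_nonneg_left (bZ t x) (hC0 a)
  have anti : AntitoneOn (fun t => ∫ x, F (lin (Z t) x) ∂(gD D)) (Set.Icc 0 (Real.pi / 2)) := by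
    refine antitoneOn_of_deriv_nonpos (convex_Icc _ _)
      (fun t _ => (key t).continuousAt.continuousWithinAt)
      (fun t _ => (key t).differentiableAt.differentiableWithinAt) fun t ht => ?_
    rw [interior_Icc] at ht
    rw [(key t).deriv, ibp _ _ hF1 g1 g2]
    refine integral_nonpos fun x => ?_
    have hs : 0 ≤ Real.sin t := Real.sin_nonneg_of_nonneg_of_le_pi ht.1.le (by linarith [ht.2, Real.pi_pos])
    have hc : 0 ≤ Real.cos t := Real.cos_nonneg_of_mem_Icc ⟨by linarith [ht.1, Real.pi_pos], ht.2.le⟩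
    have e : ∀ a b, ∑ d, Z' t a d * Z t b d
        = Real.sin t * Real.cos t * ∑ d, (P a d * P b d - Q a d * Q b d) := by
      intro a b
      have h1 := horth a b
      have h2 := horth b a
      have : ∑ d, Z' t a d * Z t b d
        = Real.sin t * Real.cos t * ∑ d, (P a d * P b d - Q a d * Q b d)
          + Real.cos t ^ 2 * ∑ d, P a d * Q b d - Real.sin t ^ 2 * ∑ d, P b d * Q a d := by
        rw [Finset.mul_sum, Finset.mul_sum, Finset.mul_sum, ← Finset.sum_add_distrib,
          ← Finset.sum_sub_distrib]
        refine Finset.sum_congr rfl fun d _ => ?_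
        simp only [Z, Z']; ring
      rw [this, h1, h2]; ring
    simp_rw [e, mul_assoc (Real.sin t * Real.cos t), ← Finset.mul_sum]
    exact mul_nonpos_of_nonneg_of_nonpos (mul_nonneg hs hc) (hneg _)
  have hp := Real.pi_pos
  have := anti (Set.left_mem_Icc.2 (by positivity)) (Set.right_mem_Icc.2 (by positivity)) (by positivity)
  simpa [hZ] using this

end GI

open MeasureTheory ProbabilityTheory
namespace GI
set_option linter.unusedSectionVars false

section grad
variable {I : Type*} [Fintype I]

def HasGrad (f : (I → ℝ) → ℝ) (g : I → ℝ) (z : I → ℝ) : Prop :=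
  HasFDerivAt f (∑ b, g b • (ContinuousLinearMap.proj b : (I → ℝ) →L[ℝ] ℝ)) z

variable {f f' : (I → ℝ) → ℝ} {g g' : I → ℝ} {z : I → ℝ}

lemma HasGrad.congr (h : HasGrad f g z) (e : ∀ b, g b = g' b) : HasGrad f g' z := by
  have : g = g' := funext e
  rwa [← this]

lemma HasGrad.proj [DecidableEq I] (a : I) :
    HasGrad (fun z => z a) (fun b => if a = b then 1 else 0) z := by
  unfold HasGrad
  have : (∑ b, (if a = b then (1:ℝ) else 0) • (ContinuousLinearMap.proj b : (I → ℝ) →L[ℝ] ℝ))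
      = ContinuousLinearMap.proj a := by
    simp
  rw [this]
  exact (ContinuousLinearMap.proj a : (I → ℝ) →L[ℝ] ℝ).hasFDerivAt

lemma HasGrad.add (h : HasGrad f g z) (h' : HasGrad f' g' z) :
    HasGrad (fun z => f z + f' z) (fun b => g b + g' b) z := by
  unfold HasGrad at *
  refine (h.add h').congr_fderiv ?_
  simp [add_smul, Finset.sum_add_distrib]

lemma HasGrad.mul (h : HasGrad f g z) (h' : HasGrad f' g' z) :
    HasGrad (fun z => f z * f' z) (fun b => f z * g' b + f' z * g b) z := by
  unfold HasGrad at *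
  refine (h.mul h').congr_fderiv ?_
  simp [add_smul, Finset.sum_add_distrib, Finset.smul_sum, smul_smul]

lemma HasGrad.comp {φ : ℝ → ℝ} {φ' : ℝ} (hφ : HasDerivAt φ φ' (f z)) (h : HasGrad f g z) :
    HasGrad (fun z => φ (f z)) (fun b => φ' * g b) z := by
  unfold HasGrad at *
  refine (hφ.comp_hasFDerivAt z h).congr_fderiv ?_
  simp [Finset.smul_sum, smul_smul]

lemma HasGrad.const (c : ℝ) : HasGrad (fun _ => c) (fun _ => 0) z := by
  unfold HasGrad
  simpa using hasFDerivAt_const c z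

lemma HasGrad.sum {ι : Type*} (s : Finset ι) {f : ι → (I → ℝ) → ℝ} {g : ι → I → ℝ}
    (h : ∀ i ∈ s, HasGrad (f i) (g i) z) :
    HasGrad (fun z => ∑ i ∈ s, f i z) (fun b => ∑ i ∈ s, g i b) z := by
  classical
  induction s using Finset.induction_on with
  | empty => simpa using HasGrad.const (z := z) 0
  | insert a s ha ih =>
    simp only [Finset.sum_insert ha]
    exact (h a (by simp)).add (ih fun i hi => h i (by simp [hi]))

lemma HasGrad.continuousAt (h : HasGrad f g z) : ContinuousAt f z := HasFDerivAt.continuousAt h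
end grad

variable {ι κ : Type*} [Fintype ι] [Fintype κ] [DecidableEq ι] [DecidableEq κ]

/-- smoothed norm -/
noncomputable def Nm (δ : ℝ) (w : ι) (z : ι × Option κ → ℝ) : ℝ :=
  Real.sqrt (δ ^ 2 + ∑ i : κ, z (w, some i) ^ 2)

noncomputable def et (δ : ℝ) (a : ι × Option κ) (z : ι × Option κ → ℝ) : ℝ :=
  match a with
  | (_, none) => 1
  | (w, some i) => z (w, some i) / Nm δ w z

noncomputable def gN (δ : ℝ) (w : ι) (z : ι × Option κ → ℝ) (b : ι × Option κ) : ℝ :=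
  match b with
  | (_, none) => 0
  | (w', some i) => if w' = w then z (w', some i) / Nm δ w' z else 0

noncomputable def Hh (δ : ℝ) (w : ι) (b : ι × Option κ) (z : ι × Option κ → ℝ) : ℝ :=
  if b.1 = w then et δ b z else 0

noncomputable def Rr (δ : ℝ) (a b : ι × Option κ) (z : ι × Option κ → ℝ) : ℝ :=
  match a with
  | (_, none) => 0
  | (w, some i) => (if (w, some i) = b then 1 else 0) / Nm δ w z
      - z (w, some i) / Nm δ w z ^ 2 * gN δ w z b

noncomputable def fw (δ p : ℝ) (w : ι) (z : ι × Option κ → ℝ) : ℝ :=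
  Real.exp (-p * (Nm δ w z + z (w, none)))

noncomputable def Ss (δ p : ℝ) (z : ι × Option κ → ℝ) : ℝ := ∑ w, fw δ p w z

noncomputable def FF (δ p θ : ℝ) (z : ι × Option κ → ℝ) : ℝ := Ss δ p z ^ θ

noncomputable def FF1 (δ p θ : ℝ) (a : ι × Option κ) (z : ι × Option κ → ℝ) : ℝ :=
  -(θ * p) * (Ss δ p z ^ (θ - 1) * (fw δ p a.1 z * et δ a z))

noncomputable def FF2 (δ p θ : ℝ) (a b : ι × Option κ) (z : ι × Option κ → ℝ) : ℝ :=
  θ * (θ - 1) * p ^ 2 * (Ss δ p z ^ (θ - 2) * fw δ p a.1 z * fw δ p b.1 z * et δ a z * et δ b z)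
  + θ * p ^ 2 * (Ss δ p z ^ (θ - 1) * fw δ p a.1 z * et δ a z * Hh δ a.1 b z)
  - θ * p * (Ss δ p z ^ (θ - 1) * fw δ p a.1 z * Rr δ a b z)

section
variable {δ p θ : ℝ} (hδ : 0 < δ)
include hδ

lemma Nm_arg_pos (w : ι) (z : ι × Option κ → ℝ) : 0 < δ ^ 2 + ∑ i : κ, z (w, some i) ^ 2 := by
  have : 0 ≤ ∑ i : κ, z (w, some i) ^ 2 := Finset.sum_nonneg fun _ _ => sq_nonneg _
  positivity

lemma Nm_pos (w : ι) (z : ι × Option κ → ℝ) : 0 < Nm δ w z := Real.sqrt_pos.2 (Nm_arg_pos hδ w z)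

lemma Nm_sq (w : ι) (z : ι × Option κ → ℝ) : Nm δ w z ^ 2 = δ ^ 2 + ∑ i : κ, z (w, some i) ^ 2 :=
  Real.sq_sqrt (Nm_arg_pos hδ w z).le

lemma le_Nm (w : ι) (z : ι × Option κ → ℝ) : δ ≤ Nm δ w z := by
  refine Real.le_sqrt_of_sq_le ?_
  have : 0 ≤ ∑ i : κ, z (w, some i) ^ 2 := Finset.sum_nonneg fun _ _ => sq_nonneg _
  linarith

lemma sum_et_sq (w : ι) (z : ι × Option κ → ℝ) : ∑ i : κ, et δ (w, some i) z ^ 2 ≤ 1 := by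
  simp only [et, div_pow]
  rw [← Finset.sum_div, Nm_sq hδ, div_le_one (Nm_arg_pos hδ w z)]
  nlinarith [sq_nonneg δ]

lemma abs_et (a : ι × Option κ) (z : ι × Option κ → ℝ) : |et δ a z| ≤ 1 := by
  obtain ⟨w, _ | i⟩ := a
  · simp [et]
  · rw [← sq_le_one_iff_abs_le_one]
    exact (Finset.single_le_sum (f := fun i : κ => et δ (w, some i) z ^ 2)
      (fun _ _ => sq_nonneg _) (Finset.mem_univ i)).trans (sum_et_sq hδ w z)

lemma Nm_grad (w : ι) (z : ι × Option κ → ℝ) : HasGrad (Nm δ w) (gN δ w z) z := by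
  unfold Nm
  have h1 : HasGrad (fun z : ι × Option κ → ℝ => δ ^ 2 + ∑ i : κ, z (w, some i) ^ 2) _ z :=
    (HasGrad.const (δ ^ 2)).add (HasGrad.sum Finset.univ (fun i _ =>
      HasGrad.comp (φ := fun x => x ^ 2) (hasDerivAt_pow 2 _) (HasGrad.proj (w, some i))))
  refine (HasGrad.comp (Real.hasDerivAt_sqrt (Nm_arg_pos hδ w z).ne') h1).congr fun b => ?_
  obtain ⟨w', _ | j⟩ := b
  · simp [gN]
  · simp only [gN, Prod.mk.injEq, Option.some.injEq]
    by_cases h : w' = w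
    · subst h
      simp [Nm]
      field_simp
    · simp [h, Ne.symm h]

lemma ph_grad (w : ι) (z : ι × Option κ → ℝ) :
    HasGrad (fun z => Nm δ w z + z (w, none)) (fun b => Hh δ w b z) z := by
  refine ((Nm_grad hδ w z).add (HasGrad.proj (w, none))).congr fun b => ?_
  obtain ⟨w', _ | j⟩ := b
  · simp [gN, Hh, et, eq_comm]
  · simp [gN, Hh, et]

lemma fw_grad (w : ι) (z : ι × Option κ → ℝ) :
    HasGrad (fw δ p w) (fun b => -p * (fw δ p w z * Hh δ w b z)) z := by
  have := HasGrad.comp (φ := fun x => Real.exp (-p * x))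
    (((hasDerivAt_id _).const_mul (-p)).exp) (ph_grad hδ w z)
  refine this.congr fun b => ?_
  simp only [fw, id]; ring

lemma Ss_grad (z : ι × Option κ → ℝ) :
    HasGrad (Ss δ p) (fun b => -p * (fw δ p b.1 z * et δ b z)) z := by
  refine (HasGrad.sum Finset.univ fun w _ => fw_grad hδ w z).congr fun b => ?_
  rw [Finset.sum_eq_single b.1]
  · simp [Hh]
  · intro w _ hw
    simp [Hh, hw.symm]
  · simp

lemma et_grad (a : ι × Option κ) (z : ι × Option κ → ℝ) :
    HasGrad (et δ a) (fun b => Rr δ a b z) z := by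
  obtain ⟨w, _ | i⟩ := a
  · exact HasGrad.const 1
  · have h := (HasGrad.proj (z := z) (w, some i)).mul
      (HasGrad.comp (hasDerivAt_inv (Nm_pos hδ w z).ne') (Nm_grad hδ w z))
    simp only [← div_eq_mul_inv] at h
    refine h.congr fun b => ?_
    simp only [Rr]
    ring

omit hδ in
lemma fw_pos (w : ι) (z : ι × Option κ → ℝ) : 0 < fw δ p w z := Real.exp_pos _

omit hδ in
lemma Ss_pos [Nonempty ι] (z : ι × Option κ → ℝ) : 0 < Ss δ p z :=
  Finset.sum_pos (fun w _ => fw_pos w z) Finset.univ_nonempty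

omit hδ in
lemma fw_le_Ss (w : ι) (z : ι × Option κ → ℝ) : fw δ p w z ≤ Ss δ p z :=
  Finset.single_le_sum (f := fun w => fw δ p w z) (fun w _ => (fw_pos w z).le) (Finset.mem_univ w)

omit hδ in
lemma FF_pos [Nonempty ι] (z : ι × Option κ → ℝ) : 0 < FF δ p θ z :=
  Real.rpow_pos_of_pos (Ss_pos z) _

lemma FF_grad [Nonempty ι] (z : ι × Option κ → ℝ) :
    HasGrad (FF δ p θ) (fun b => FF1 δ p θ b z) z := by
  refine (HasGrad.comp (Real.hasDerivAt_rpow_const (p := θ) (Or.inl (Ss_pos z).ne'))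
    (Ss_grad (p := p) hδ z)).congr fun b => ?_
  simp only [FF1]; ring

lemma FF1_grad [Nonempty ι] (a : ι × Option κ) (z : ι × Option κ → ℝ) :
    HasGrad (FF1 δ p θ a) (fun b => FF2 δ p θ a b z) z := by
  have h1 := HasGrad.comp (Real.hasDerivAt_rpow_const (p := θ - 1) (Or.inl (Ss_pos z).ne'))
    (Ss_grad (p := p) hδ z)
  refine ((HasGrad.const (-(θ * p))).mul
    (h1.mul ((fw_grad (p := p) hδ a.1 z).mul (et_grad hδ a z)))).congr fun b => ?_
  simp only [FF2]
  rw [show θ - 1 - 1 = θ - 2 by ring]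
  ring

lemma cont_of_grad {f : (ι × Option κ → ℝ) → ℝ} {g : (ι × Option κ → ℝ) → ι × Option κ → ℝ}
    (h : ∀ z, HasGrad f (g z) z) : Continuous f :=
  continuous_iff_continuousAt.2 fun z => (h z).continuousAt

lemma Rr_bound (a b : ι × Option κ) (z : ι × Option κ → ℝ) : |Rr δ a b z| ≤ 2 / δ := by
  obtain ⟨w, _ | i⟩ := a
  · simp only [Rr, abs_zero]; positivity
  · have hN := Nm_pos hδ w z
    have h1 : |(if (w, some i) = b then (1:ℝ) else 0) / Nm δ w z| ≤ 1 / δ := by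
      rw [abs_div, abs_of_pos hN]
      refine div_le_div₀ zero_le_one ?_ hδ (le_Nm hδ w z)
      split_ifs <;> simp
    have h2 : |z (w, some i) / Nm δ w z ^ 2 * gN δ w z b| ≤ 1 / δ := by
      have e : z (w, some i) / Nm δ w z ^ 2 = et δ (w, some i) z * (1 / Nm δ w z) := by
        simp only [et]; field_simp
      have g : |gN δ w z b| ≤ 1 := by
        obtain ⟨w', _ | j⟩ := b
        · simp [gN]
        · simp only [gN]
          split_ifs
          · exact abs_et hδ (w', some j) z
          · simp
      rw [e, abs_mul, abs_mul, abs_of_pos (one_div_pos.2 hN)]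
      calc _ ≤ 1 * (1 / δ) * 1 := by
            gcongr
            · exact abs_et hδ _ _
            · exact le_Nm hδ w z
        _ = _ := by ring
    simp only [Rr]
    refine (abs_sub _ _).trans ?_
    calc _ ≤ 1 / δ + 1 / δ := add_le_add h1 h2
      _ = _ := by ring

lemma gN_cont (w : ι) (b : ι × Option κ) : Continuous (fun z => gN δ w z b) := by
  obtain ⟨w', _ | j⟩ := b
  · exact continuous_const
  · simp only [gN]
    split_ifs
    · exact cont_of_grad hδ (et_grad hδ (w', some j))
    · exact continuous_const

lemma Rr_cont (a b : ι × Option κ) : Continuous (Rr δ a b) := by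
  obtain ⟨w, _ | i⟩ := a
  · exact continuous_const
  · have hN : Continuous (Nm (κ := κ) δ w) := cont_of_grad hδ (Nm_grad hδ w)
    have := gN_cont hδ w b
    unfold Rr
    refine (Continuous.div continuous_const hN fun z => (Nm_pos hδ w z).ne').sub
      (Continuous.mul (Continuous.div (by fun_prop) (hN.pow 2)
        fun z => (pow_pos (Nm_pos hδ w z) 2).ne') this)

lemma Hh_bound (w : ι) (b : ι × Option κ) (z : ι × Option κ → ℝ) : |Hh δ w b z| ≤ 1 := by
  unfold Hh; split_ifs
  · exact abs_et hδ b z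
  · simp

lemma Hh_cont (w : ι) (b : ι × Option κ) : Continuous (Hh δ w b) := by
  unfold Hh; split_ifs
  · exact cont_of_grad hδ (et_grad hδ b)
  · exact continuous_const

lemma fw_Gr (hp : 0 ≤ p) (w : ι) : Gr (fw (κ := κ) δ p w) := by
  refine Gr.of_le (cont_of_grad hδ (fw_grad hδ w)) (Gr.exp_norm p hp) fun z => ?_
  rw [abs_of_pos (fw_pos w z), abs_of_pos (Real.exp_pos _)]
  refine Real.exp_le_exp.2 ?_
  have h1 := (Nm_pos hδ w z).le
  have h2 : -z (w, none) ≤ ‖z‖ := (neg_le_abs _).trans (norm_le_pi_norm z _)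
  nlinarith

lemma FF_Gr [Nonempty ι] (hp : 0 ≤ p) (h0 : 0 < θ) (h1 : θ < 1) : Gr (FF (ι := ι) (κ := κ) δ p θ) := by
  have : Gr (fun z : ι × Option κ → ℝ => 1 + Ss δ p z) :=
    (Gr.const 1).add (Gr.sum _ fun w _ => fw_Gr hδ hp w)
  refine Gr.of_le (cont_of_grad hδ (FF_grad hδ)) this fun z => ?_
  have hS := Ss_pos (δ := δ) (p := p) z
  rw [abs_of_pos (FF_pos z), abs_of_pos (by linarith)]
  unfold FF
  rcases le_total (Ss δ p z) 1 with h | h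
  · have := Real.rpow_le_one hS.le h h0.le
    linarith
  · calc _ ≤ Ss δ p z ^ (1:ℝ) := Real.rpow_le_rpow_of_exponent_le h h1.le
      _ ≤ _ := by rw [Real.rpow_one]; linarith

lemma aux1 [Nonempty ι] (w : ι) (z : ι × Option κ → ℝ) :
    |Ss δ p z ^ (θ - 1) * fw δ p w z| ≤ |FF δ p θ z| := by
  have hS := Ss_pos (δ := δ) (p := p) z
  have hf := fw_pos (δ := δ) (p := p) w z
  have hr := Real.rpow_pos_of_pos hS (θ - 1)
  rw [abs_of_pos (mul_pos hr hf), abs_of_pos (FF_pos z)]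
  calc _ ≤ Ss δ p z ^ (θ - 1) * Ss δ p z := by gcongr; exact fw_le_Ss w z
    _ = _ := by
      unfold FF
      rw [← Real.rpow_add_one hS.ne']; congr 1; ring

lemma aux2 [Nonempty ι] (w w' : ι) (z : ι × Option κ → ℝ) :
    |Ss δ p z ^ (θ - 2) * fw δ p w z * fw δ p w' z| ≤ |FF δ p θ z| := by
  have hS := Ss_pos (δ := δ) (p := p) z
  have hf := fw_pos (δ := δ) (p := p) w z
  have hf' := fw_pos (δ := δ) (p := p) w' z
  have hr := Real.rpow_pos_of_pos hS (θ - 2)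
  rw [abs_of_pos (by positivity), abs_of_pos (FF_pos z)]
  calc _ ≤ Ss δ p z ^ (θ - 2) * Ss δ p z * Ss δ p z := by
        gcongr
        · exact fw_le_Ss w z
        · exact fw_le_Ss w' z
    _ = _ := by
      unfold FF
      rw [← Real.rpow_add_one hS.ne', ← Real.rpow_add_one hS.ne']; congr 1; ring

lemma FF1_Gr [Nonempty ι] (hp : 0 ≤ p) (h0 : 0 < θ) (h1 : θ < 1) (a : ι × Option κ) :
    Gr (FF1 (ι := ι) (κ := κ) δ p θ a) := by
  refine Gr.of_le (cont_of_grad hδ (FF1_grad hδ a))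
    ((Gr.const (θ * p)).mul (FF_Gr hδ hp h0 h1)) fun z => ?_
  unfold FF1
  rw [← mul_assoc (Ss δ p z ^ (θ - 1)), abs_mul, abs_mul, abs_neg, abs_mul (θ * p)]
  gcongr
  calc _ ≤ |FF δ p θ z| * 1 := mul_le_mul (aux1 hδ _ _) (abs_et hδ _ _) (abs_nonneg _) (abs_nonneg _)
    _ = _ := mul_one _

lemma FF2_Gr [Nonempty ι] (hp : 0 ≤ p) (h0 : 0 < θ) (h1 : θ < 1) (a b : ι × Option κ) :
    Gr (FF2 (ι := ι) (κ := κ) δ p θ a b) := by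
  have cS : Continuous (Ss (ι := ι) (κ := κ) δ p) := cont_of_grad hδ (Ss_grad hδ)
  have cr : ∀ s : ℝ, Continuous (fun z : ι × Option κ → ℝ => Ss δ p z ^ s) := fun s =>
    cS.rpow_const fun z => Or.inl (Ss_pos z).ne'
  have cf : ∀ w : ι, Continuous (fw (κ := κ) δ p w) := fun w => cont_of_grad hδ (fw_grad hδ w)
  have ce : ∀ a : ι × Option κ, Continuous (et (ι := ι) (κ := κ) δ a) := fun a => cont_of_grad hδ (et_grad hδ a)
  have gF := FF_Gr (ι := ι) (κ := κ) hδ hp h0 h1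
  have t1 : Gr (fun z : ι × Option κ → ℝ =>
      Ss δ p z ^ (θ - 2) * fw δ p a.1 z * fw δ p b.1 z * et δ a z * et δ b z) := by
    refine Gr.of_le (((((cr _).mul (cf _)).mul (cf _)).mul (ce _)).mul (ce _)) gF fun z => ?_
    rw [abs_mul, abs_mul]
    calc _ ≤ |FF δ p θ z| * 1 * 1 := 
          mul_le_mul (mul_le_mul (aux2 hδ _ _ _) (abs_et hδ _ _) (abs_nonneg _) (abs_nonneg _))
            (abs_et hδ _ _) (abs_nonneg _) (by positivity)
      _ = _ := by ring
  have t2 : Gr (fun z : ι × Option κ → ℝ =>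
      Ss δ p z ^ (θ - 1) * fw δ p a.1 z * et δ a z * Hh δ a.1 b z) := by
    refine Gr.of_le ((((cr _).mul (cf _)).mul (ce _)).mul (Hh_cont hδ _ _)) gF fun z => ?_
    rw [abs_mul, abs_mul]
    calc _ ≤ |FF δ p θ z| * 1 * 1 := 
          mul_le_mul (mul_le_mul (aux1 hδ _ _) (abs_et hδ _ _) (abs_nonneg _) (abs_nonneg _))
            (Hh_bound hδ _ _ _) (abs_nonneg _) (by positivity)
      _ = _ := by ring
  have t3 : Gr (fun z : ι × Option κ → ℝ =>
      Ss δ p z ^ (θ - 1) * fw δ p a.1 z * Rr δ a b z) := by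
    refine Gr.of_le ((((cr _).mul (cf _))).mul (Rr_cont hδ _ _)) (gF.mul (Gr.const (2 / δ)))
      fun z => ?_
    rw [abs_mul, abs_mul (FF δ p θ z), abs_of_pos (by positivity : 0 < 2 / δ)]
    exact mul_le_mul (aux1 hδ _ _) (Rr_bound hδ _ _ _) (abs_nonneg _) (abs_nonneg _)
  have := (((Gr.const (θ * (θ - 1) * p ^ 2)).mul t1).add ((Gr.const (θ * p ^ 2)).mul t2)).add
    ((Gr.const (-(θ * p))).mul t3)
  convert this using 2 with z
  unfold FF2; ring

omit hδ in
lemma FF2_off {a b : ι × Option κ} (h : a.1 ≠ b.1) (z : ι × Option κ → ℝ) :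
    FF2 δ p θ a b z = θ * (θ - 1) * p ^ 2 *
      (Ss δ p z ^ (θ - 2) * fw δ p a.1 z * fw δ p b.1 z) * (et δ a z * et δ b z) := by
  have h1 : Hh δ a.1 b z = 0 := by simp [Hh, h.symm]
  have h2 : Rr δ a b z = 0 := by
    obtain ⟨w, _ | i⟩ := a
    · rfl
    · obtain ⟨w', _ | j⟩ := b
      · simp [Rr, gN]
      · simp only [ne_eq] at h
        simp [Rr, gN, h, Ne.symm h]
  unfold FF2
  rw [h1, h2]; ring

def sg (i j : Option κ) : ℝ :=
  match i, j with
  | none, none => 1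
  | some i, some j => if i = j then -1 else 0
  | _, _ => 0

lemma FF_neg [Nonempty ι] (h0 : 0 < θ) (h1 : θ < 1) (ρ : ι → ι → ℝ) (hρ : ∀ w w', 0 ≤ ρ w w')
    (hρ0 : ∀ w, ρ w w = 0) (z : ι × Option κ → ℝ) :
    ∑ a : ι × Option κ, ∑ b : ι × Option κ, (ρ a.1 b.1 * sg a.2 b.2) * FF2 δ p θ a b z ≤ 0 := by
  simp only [Fintype.sum_prod_type]
  have : ∀ w : ι, ∑ i : Option κ, ∑ w' : ι, ∑ j : Option κ, ρ w w' * sg i j * FF2 δ p θ (w, i) (w', j) z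
      = ∑ w' : ι, ∑ i : Option κ, ∑ j : Option κ, ρ w w' * sg i j * FF2 δ p θ (w, i) (w', j) z :=
    fun w => Finset.sum_comm
  simp_rw [this]
  refine Finset.sum_nonpos fun w _ => Finset.sum_nonpos fun w' _ => ?_
  by_cases hw : w = w'
  · subst hw; simp [hρ0]
  have e : ∀ i j, FF2 δ p θ (w, i) (w', j) z = θ * (θ - 1) * p ^ 2 *
      (Ss δ p z ^ (θ - 2) * fw δ p w z * fw δ p w' z) * (et δ (w, i) z * et δ (w', j) z) :=
    fun i j => FF2_off (a := (w, i)) (b := (w', j)) hw z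
  simp_rw [e]
  set c := θ * (θ - 1) * p ^ 2 * (Ss δ p z ^ (θ - 2) * fw δ p w z * fw δ p w' z) with hc
  have hc0 : c ≤ 0 := by
    have hS := Ss_pos (δ := δ) (p := p) z
    have hf := fw_pos (δ := δ) (p := p) w z
    have hf' := fw_pos (δ := δ) (p := p) w' z
    have hr := Real.rpow_pos_of_pos hS (θ - 2)
    refine mul_nonpos_of_nonpos_of_nonneg ?_ (by positivity)
    refine mul_nonpos_of_nonpos_of_nonneg ?_ (by positivity)
    exact mul_nonpos_of_nonneg_of_nonpos h0.le (by linarith)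
  have e2 : ∑ i : Option κ, ∑ j : Option κ, ρ w w' * sg i j * (c * (et δ (w, i) z * et δ (w', j) z))
      = ρ w w' * c * (1 - ∑ i : κ, et δ (w, some i) z * et δ (w', some i) z) := by
    simp only [Fintype.sum_option, sg]
    simp only [mul_zero, zero_mul, Finset.sum_const_zero, add_zero, zero_add, mul_ite, ite_mul,
      Finset.sum_ite_eq, Finset.mem_univ, if_true, et]
    rw [mul_sub, Finset.mul_sum, sub_eq_add_neg, ← Finset.sum_neg_distrib]
    congr 1
    · ring
    · exact Finset.sum_congr rfl fun i _ => by ring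
  rw [e2]
  refine mul_nonpos_of_nonpos_of_nonneg (mul_nonpos_of_nonneg_of_nonpos (hρ _ _) hc0) ?_
  have s1 := sum_et_sq hδ w z
  have s2 := sum_et_sq hδ w' z
  have s3 : ∑ i : κ, et δ (w, some i) z * et δ (w', some i) z
      ≤ ∑ i : κ, (et δ (w, some i) z ^ 2 + et δ (w', some i) z ^ 2) / 2 :=
    Finset.sum_le_sum fun i _ => by
      nlinarith [sq_nonneg (et δ (w, some i) z - et δ (w', some i) z)]
  rw [← Finset.sum_div, Finset.sum_add_distrib] at s3
  linarith

end
end GI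

open MeasureTheory ProbabilityTheory
namespace GI
set_option linter.unusedSectionVars false
set_option linter.unusedSimpArgs false

lemma integral_split {D1 D2 : Type*} [Fintype D1] [Fintype D2] (G1 : (D1 → ℝ) → ℝ)
    (G2 : (D2 → ℝ) → ℝ) :
    ∫ x : D1 ⊕ D2 → ℝ, G1 (fun d => x (Sum.inl d)) * G2 (fun d => x (Sum.inr d)) ∂(gD (D1 ⊕ D2))
      = (∫ x, G1 x ∂(gD D1)) * ∫ x, G2 x ∂(gD D2) := by
  have h := (measurePreserving_sumPiEquivProdPi (X := fun _ : D1 ⊕ D2 => ℝ)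
    (fun _ : D1 ⊕ D2 => g1)).integral_comp' (fun q : (D1 → ℝ) × (D2 → ℝ) => G1 q.1 * G2 q.2)
  rw [integral_prod_mul] at h
  exact h

lemma integral_one_coord {D : Type*} [Fintype D] (d : D) (f : ℝ → ℝ) :
    Integrable f g1 → ∫ x : D → ℝ, f (x d) ∂(gD D) = ∫ s, f s ∂g1 := by
  intro hf
  exact integral_comp_eval (μ := fun _ : D => g1) (i := d) hf.aestronglyMeasurable

section
variable {m n : ℕ} {ι : Type*} [Fintype ι] [DecidableEq ι]

abbrev DD (m n : ℕ) := (Fin m × Fin n) ⊕ Option (Fin m ⊕ Fin n)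

def PP (w : ι → Fin n → ℝ) (a : ι × Option (Fin m)) (d : DD m n) : ℝ :=
  match a, d with
  | (k, some i), Sum.inl (i', j) => if i = i' then w k j else 0
  | (_, none), Sum.inr none => 1
  | _, _ => 0

def QQ (w : ι → Fin n → ℝ) (a : ι × Option (Fin m)) (d : DD m n) : ℝ :=
  match a, d with
  | (_, some i), Sum.inr (some (Sum.inl i')) => if i = i' then 1 else 0
  | (k, none), Sum.inr (some (Sum.inr j)) => - w k j
  | _, _ => 0

lemma linPP_some (w : ι → Fin n → ℝ) (x : DD m n → ℝ) (k : ι) (i : Fin m) :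
    lin (PP w) x (k, some i) = ∑ j, x (Sum.inl (i, j)) * w k j := by
  rw [lin_apply]
  simp only [Fintype.sum_sum_type, Fintype.sum_option, Fintype.sum_prod_type, PP]
  simp only [zero_mul, Finset.sum_const_zero, add_zero, ite_mul]
  rw [Finset.sum_comm]
  simp [mul_comm]

lemma linPP_none (w : ι → Fin n → ℝ) (x : DD m n → ℝ) (k : ι) :
    lin (PP w) x (k, none) = x (Sum.inr none) := by
  rw [lin_apply]
  simp [Fintype.sum_sum_type, Fintype.sum_option, Fintype.sum_prod_type, PP]

lemma linQQ_some (w : ι → Fin n → ℝ) (x : DD m n → ℝ) (k : ι) (i : Fin m) :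
    lin (QQ w) x (k, some i) = x (Sum.inr (some (Sum.inl i))) := by
  rw [lin_apply]
  simp [Fintype.sum_sum_type, Fintype.sum_option, Fintype.sum_prod_type, QQ]

lemma linQQ_none (w : ι → Fin n → ℝ) (x : DD m n → ℝ) (k : ι) :
    lin (QQ w) x (k, none) = -∑ j, w k j * x (Sum.inr (some (Sum.inr j))) := by
  rw [lin_apply]
  simp [Fintype.sum_sum_type, Fintype.sum_option, Fintype.sum_prod_type, QQ]

lemma PPQQ_cov (w : ι → Fin n → ℝ) (a b : ι × Option (Fin m)) :
    ∑ d : DD m n, (PP w a d * PP w b d - QQ w a d * QQ w b d)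
      = (1 - ∑ j, w a.1 j * w b.1 j) * sg a.2 b.2 := by
  obtain ⟨k, _ | i⟩ := a <;> obtain ⟨l, _ | i'⟩ := b
  · simp [Fintype.sum_sum_type, Fintype.sum_option, Fintype.sum_prod_type, PP, QQ, sg]
  · simp [Fintype.sum_sum_type, Fintype.sum_option, Fintype.sum_prod_type, PP, QQ, sg]
  · simp [Fintype.sum_sum_type, Fintype.sum_option, Fintype.sum_prod_type, PP, QQ, sg]
  · by_cases h : i = i'
    · subst h
      simp [Fintype.sum_sum_type, Fintype.sum_option, Fintype.sum_prod_type, PP, QQ, sg]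
    · have h1 : ∀ c : Fin m, ∀ u v : ℝ, (if i = c then u else 0) * (if i' = c then v else 0) = 0 := by
        intro c u v
        split_ifs with h1 h2
        · exact absurd (h1.trans h2.symm) h
        all_goals simp
      simp [Fintype.sum_sum_type, Fintype.sum_option, Fintype.sum_prod_type, PP, QQ, sg, h, h1, Ne.symm h]

lemma PPQQ_orth (w : ι → Fin n → ℝ) (a b : ι × Option (Fin m)) :
    ∑ d : DD m n, PP w a d * QQ w b d = 0 := by
  obtain ⟨k, _ | i⟩ := a <;> obtain ⟨l, _ | i'⟩ := b <;>
  simp [Fintype.sum_sum_type, Fintype.sum_option, Fintype.sum_prod_type, PP, QQ]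

theorem gordon [Nonempty ι] (w : ι → Fin n → ℝ) (hw : ∀ k, ∑ j, w k j ^ 2 = 1) {δ p θ : ℝ}
    (hδ : 0 < δ) (hp : 0 ≤ p) (h0 : 0 < θ) (h1 : θ < 1) :
    ∫ x, FF δ p θ (lin (PP w) x) ∂(gD (DD m n)) ≤ ∫ x, FF δ p θ (lin (QQ w) x) ∂(gD (DD m n)) := by
  refine interp (PP w) (QQ w) (FF_grad hδ) (fun a => FF1_grad hδ a) (FF_Gr hδ hp h0 h1)
    (fun a => FF1_Gr hδ hp h0 h1 a) (fun a b => FF2_Gr hδ hp h0 h1 a b) (PPQQ_orth w) fun z => ?_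
  simp_rw [PPQQ_cov]
  refine FF_neg hδ h0 h1 (fun k l => 1 - ∑ j, w k j * w l j) (fun k l => ?_) (fun k => ?_) z
  · have : ∑ j, w k j * w l j ≤ ∑ j, (w k j ^ 2 + w l j ^ 2) / 2 :=
      Finset.sum_le_sum fun j _ => by nlinarith [sq_nonneg (w k j - w l j)]
    rw [← Finset.sum_div, Finset.sum_add_distrib, hw, hw] at this
    linarith
  · have := hw k
    simp only [pow_two] at this
    rw [this, sub_self]

/-- matrix-only functional -/
noncomputable def Phi (δ p θ : ℝ) (w : ι → Fin n → ℝ) (A : Fin m × Fin n → ℝ) : ℝ :=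
  (∑ k, Real.exp (-p * Real.sqrt (δ ^ 2 + ∑ i, (∑ j, A (i, j) * w k j) ^ 2))) ^ θ

lemma FF_PP (w : ι → Fin n → ℝ) (δ p θ : ℝ) (x : DD m n → ℝ) :
    FF δ p θ (lin (PP w) x)
      = Phi δ p θ w (fun d => x (Sum.inl d)) * Real.exp (-(p * θ) * x (Sum.inr none)) := by
  unfold FF Ss fw Phi Nm
  simp only [linPP_some, linPP_none, mul_add, Real.exp_add, ← Finset.sum_mul]
  rw [Real.mul_rpow (Finset.sum_nonneg fun _ _ => (Real.exp_pos _).le) (Real.exp_pos _).le,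
    ← Real.exp_mul]
  congr 2
  ring

lemma gordon_Phi [Nonempty ι] (w : ι → Fin n → ℝ) (hw : ∀ k, ∑ j, w k j ^ 2 = 1) {δ p θ : ℝ}
    (hδ : 0 < δ) (hp : 0 ≤ p) (h0 : 0 < θ) (h1 : θ < 1) 
    (U : (Option (Fin m ⊕ Fin n) → ℝ) → ℝ) (hU : Integrable U (gD _))
    (hUb : ∀ k x, Real.exp (p * θ * (∑ j, w k j * x (some (Sum.inr j))
      - Real.sqrt (∑ i, x (some (Sum.inl i)) ^ 2))) ≤ U x) :
    Real.exp ((p * θ) ^ 2 / 2) * ∫ A, Phi δ p θ w A ∂(gD (Fin m × Fin n))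
      ≤ (Fintype.card ι : ℝ) ^ θ * ∫ x, U x ∂(gD _) := by
  have h := gordon (m := m) w hw hδ hp h0 h1
  have e1 : ∫ x, FF δ p θ (lin (PP w) x) ∂(gD (DD m n))
      = (∫ A, Phi δ p θ w A ∂(gD (Fin m × Fin n))) * Real.exp ((p * θ) ^ 2 / 2) := by
    simp_rw [FF_PP]
    have := integral_split (D1 := Fin m × Fin n) (D2 := Option (Fin m ⊕ Fin n)) (Phi δ p θ w)
      (fun x => Real.exp (-(p * θ) * x none))
    rw [this]
    congr 1
    rw [integral_one_coord none (fun s => Real.exp (-(p * θ) * s)) (integrable_exp_mul_gaussianReal _)]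
    have := congrFun (mgf_id_gaussianReal (μ := 0) (v := 1)) (-(p * θ))
    simp only [mgf, id] at this
    rw [this]; simp
  rw [e1, mul_comm] at h
  refine h.trans ?_
  have e2 : (Fintype.card ι : ℝ) ^ θ * ∫ x, U x ∂(gD _)
      = ∫ x : DD m n → ℝ, (Fintype.card ι : ℝ) ^ θ * U (fun d => x (Sum.inr d)) ∂(gD (DD m n)) := by
    have := integral_split (D1 := Fin m × Fin n) (D2 := Option (Fin m ⊕ Fin n))
      (fun _ => (Fintype.card ι : ℝ) ^ θ) U
    rw [this]; simp
  rw [e2]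
  have iU : Integrable (fun x : DD m n → ℝ => U (fun d => x (Sum.inr d))) (gD (DD m n)) := by
    have mp := (measurePreserving_snd (μ := gD (Fin m × Fin n)) (ν := gD (Option (Fin m ⊕ Fin n)))).comp
      (measurePreserving_sumPiEquivProdPi (X := fun _ : DD m n => ℝ) (fun _ : DD m n => g1))
    exact mp.integrable_comp_of_integrable hU
  refine integral_mono ((FF_Gr hδ hp h0 h1).comp_lin _).integrable (iU.const_mul _) fun x => ?_
  simp only
  set y : Option (Fin m ⊕ Fin n) → ℝ := fun d => x (Sum.inr d) with hy
  obtain ⟨k0⟩ := ‹Nonempty ι›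
  have U0 : 0 < U y := (Real.exp_pos _).trans_le (hUb k0 y)
  have hb : ∀ k, fw δ p k (lin (QQ w) x) ≤ U y ^ (1 / θ) := by
    intro k
    have h2 := Real.rpow_le_rpow (Real.exp_pos _).le (hUb k y) (one_div_pos.2 h0).le
    refine le_trans ?_ h2
    rw [← Real.exp_mul]
    refine Real.exp_le_exp.2 ?_
    have e : p * θ * (∑ j, w k j * y (some (Sum.inr j)) - Real.sqrt (∑ i, y (some (Sum.inl i)) ^ 2))
        * (1 / θ) = p * (∑ j, w k j * y (some (Sum.inr j)) - Real.sqrt (∑ i, y (some (Sum.inl i)) ^ 2)) := by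
      field_simp
    rw [e, linQQ_none]
    have h3 : Real.sqrt (∑ i, y (some (Sum.inl i)) ^ 2) ≤ Nm δ k (lin (QQ w) x) := by
      unfold Nm
      refine Real.sqrt_le_sqrt ?_
      simp only [linQQ_some, hy]
      nlinarith [sq_nonneg δ]
    have h4 := mul_le_mul_of_nonneg_left h3 hp
    simp only [hy] at h4 ⊢
    linarith
  have hS : Ss δ p (lin (QQ w) x) ≤ Fintype.card ι * U y ^ (1 / θ) := by
    unfold Ss
    refine (Finset.sum_le_sum fun k _ => hb k).trans ?_
    simp
  unfold FF
  refine (Real.rpow_le_rpow (Finset.sum_nonneg fun k _ => (fw_pos k _).le) hS h0.le).trans ?_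
  rw [Real.mul_rpow (by positivity) (Real.rpow_nonneg U0.le _), ← Real.rpow_mul U0.le,
    one_div_mul_cancel h0.ne', Real.rpow_one]

lemma Phi_cont [Nonempty ι] (w : ι → Fin n → ℝ) (δ p θ : ℝ) : Continuous (Phi (m := m) δ p θ w) := by
  unfold Phi
  refine Continuous.rpow_const (by fun_prop) fun A => Or.inl ?_
  exact (Finset.sum_pos (fun _ _ => Real.exp_pos _) Finset.univ_nonempty).ne'

lemma Phi_pos [Nonempty ι] (w : ι → Fin n → ℝ) (δ p θ : ℝ) (A : Fin m × Fin n → ℝ) :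
    0 < Phi (m := m) δ p θ w A := 
  Real.rpow_pos_of_pos (Finset.sum_pos (fun _ _ => Real.exp_pos _) Finset.univ_nonempty) _

lemma Phi_integrable [Nonempty ι] (w : ι → Fin n → ℝ) {δ p θ : ℝ} (hp : 0 ≤ p) (h0 : 0 < θ) :
    Integrable (Phi (m := m) δ p θ w) (gD _) := by
  refine Integrable.of_bound (C := (Fintype.card ι : ℝ) ^ θ)
    (Phi_cont w δ p θ).aestronglyMeasurable (Filter.Eventually.of_forall fun A => ?_)
  rw [Real.norm_eq_abs, abs_of_pos (Phi_pos _ _ _ _ _)]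
  unfold Phi
  refine Real.rpow_le_rpow (Finset.sum_nonneg fun _ _ => (Real.exp_pos _).le) ?_ h0.le
  refine (Finset.sum_le_sum fun k _ => (?_ : _ ≤ (1:ℝ))).trans (by simp)
  rw [Real.exp_le_one_iff]
  have := Real.sqrt_nonneg (δ ^ 2 + ∑ i, (∑ j, A (i, j) * w k j) ^ 2)
  nlinarith

/-- Gordon for finite sets, probability version. -/
theorem gordon_prob [Nonempty ι] (w : ι → Fin n → ℝ) (hw : ∀ k, ∑ j, w k j ^ 2 = 1) {C τ : ℝ}
    (hC : 0 < C) (hτ : 0 < τ)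
    (U : (Option (Fin m ⊕ Fin n) → ℝ) → ℝ) (hU : Integrable U (gD _))
    (hUb : ∀ k x, Real.exp (C * (∑ j, w k j * x (some (Sum.inr j))
      - Real.sqrt (∑ i, x (some (Sum.inl i)) ^ 2))) ≤ U x) :
    Real.exp (C ^ 2 / 2) * (Real.exp (-(2 * C * τ)) *
      (gD (Fin m × Fin n)).real {A | ∃ k, ∑ i, (∑ j, A (i, j) * w k j) ^ 2 ≤ τ ^ 2})
      ≤ ∫ x, U x ∂(gD _) := by
  have key : ∀ θ : ℝ, 0 < θ → θ < 1 → Real.exp (C ^ 2 / 2) * (Real.exp (-(2 * C * τ)) *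
      (gD (Fin m × Fin n)).real {A | ∃ k, ∑ i, (∑ j, A (i, j) * w k j) ^ 2 ≤ τ ^ 2})
      ≤ (Fintype.card ι : ℝ) ^ θ * ∫ x, U x ∂(gD _) := by
    intro θ h0 h1
    have hp : 0 ≤ C / θ := by positivity
    have e : C / θ * θ = C := by field_simp
    have h := gordon_Phi (m := m) w hw hτ hp h0 h1 U hU (by rw [e]; exact hUb)
    rw [e] at h
    refine le_trans ?_ h
    gcongr
    refine le_trans ?_ (mul_meas_ge_le_integral_of_nonneg
      (Filter.Eventually.of_forall fun A => (Phi_pos _ _ _ _ _).le)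
      (Phi_integrable (m := m) (δ := τ) w hp h0) (Real.exp (-(2 * C * τ))))
    refine mul_le_mul_of_nonneg_left (measureReal_mono ?_ (measure_ne_top _ _)) (Real.exp_pos _).le
    · rintro A ⟨k, hk⟩
      simp only [Set.mem_setOf_eq]
      have h2 : Real.sqrt (τ ^ 2 + ∑ i, (∑ j, A (i, j) * w k j) ^ 2) ≤ 2 * τ := by
        rw [Real.sqrt_le_left (by positivity)]
        nlinarith [sq_nonneg τ]
      have h3 : Real.exp (-(C / θ) * (2 * τ)) ≤
          ∑ k, Real.exp (-(C / θ) * Real.sqrt (τ ^ 2 + ∑ i, (∑ j, A (i, j) * w k j) ^ 2)) := by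
        refine le_trans ?_ (Finset.single_le_sum (f := fun k => Real.exp (-(C / θ) * 
          Real.sqrt (τ ^ 2 + ∑ i, (∑ j, A (i, j) * w k j) ^ 2)))
          (fun _ _ => (Real.exp_pos _).le) (Finset.mem_univ k))
        refine Real.exp_le_exp.2 ?_
        nlinarith
      have h4 := Real.rpow_le_rpow (Real.exp_pos _).le h3 h0.le
      rw [← Real.exp_mul] at h4
      unfold Phi
      refine le_trans (le_of_eq ?_) h4
      congr 1
      field_simp
  have lim : Filter.Tendsto (fun θ : ℝ => (Fintype.card ι : ℝ) ^ θ * ∫ x, U x ∂(gD (Option (Fin m ⊕ Fin n))))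
      (nhdsWithin 0 (Set.Ioi 0)) (nhds ((Fintype.card ι : ℝ) ^ (0:ℝ) * ∫ x, U x ∂(gD _))) := by
    refine Filter.Tendsto.mul_const _ (tendsto_nhdsWithin_of_tendsto_nhds ?_)
    refine (Real.continuousAt_const_rpow ?_).tendsto
    exact_mod_cast Fintype.card_ne_zero
  rw [Real.rpow_zero, one_mul] at lim
  refine ge_of_tendsto lim ?_
  filter_upwards [Ioo_mem_nhdsGT (zero_lt_one' ℝ)] with θ hθ
  exact key θ hθ.1 hθ.2

end
end GI

open MeasureTheory ProbabilityTheory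
namespace GI

lemma gordon_set_R {m n : ℕ} (S : Set (Fin n → ℝ)) (hS : ∀ w ∈ S, ∑ j, w j ^ 2 = 1) (hne : S.Nonempty)
    {C τ R : ℝ} (hC : 0 < C) (hτ : 0 < τ) (hR : 0 < R)
    (U : (Option (Fin m ⊕ Fin n) → ℝ) → ℝ) (hU : Integrable U (gD _))
    (hUb : ∀ w ∈ S, ∀ x, Real.exp (C * (∑ j, w j * x (some (Sum.inr j))
      - Real.sqrt (∑ i, x (some (Sum.inl i)) ^ 2))) ≤ U x) :
    Real.exp (C ^ 2 / 2) * (Real.exp (-(2 * C * τ)) *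
      (gD (Fin m × Fin n)).real {A | (∃ w ∈ S, ∀ i, ∑ j, A (i, j) * w j = 0) ∧ ∀ d, |A d| ≤ R})
      ≤ ∫ x, U x ∂(gD _) := by
  classical
  have hb : TotallyBounded S := by
    refine (isCompact_closedBall (0 : Fin n → ℝ) 1).totallyBounded.subset fun w hw => ?_
    rw [mem_closedBall_zero_iff, pi_norm_le_iff_of_nonneg zero_le_one]
    intro j
    have h1 : w j ^ 2 ≤ 1 := by
      rw [← hS w hw]
      exact Finset.single_le_sum (f := fun j => w j ^ 2) (fun _ _ => sq_nonneg _) (Finset.mem_univ j)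
    rw [Real.norm_eq_abs]
    exact (sq_le_one_iff_abs_le_one _).1 h1
  set r : ℝ := τ / ((m + 1) * (n * R + 1)) with hr
  have hr0 : 0 < r := by positivity
  obtain ⟨t, htS, htf, hcov⟩ := Metric.finite_approx_of_totallyBounded hb r hr0
  obtain ⟨w0, hw0⟩ := hne
  have hw0' := hcov hw0
  simp only [Set.mem_iUnion] at hw0'
  obtain ⟨y0, hy0, -⟩ := hw0'
  haveI : Fintype t := htf.fintype
  have : Nonempty t := ⟨⟨y0, hy0⟩⟩
  refine le_trans ?_ (gordon_prob (m := m) (ι := t) (fun k => (k : Fin n → ℝ))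
    (fun k => hS _ (htS k.2)) hC hτ U hU fun k x => hUb _ (htS k.2) x)
  refine mul_le_mul_of_nonneg_left (mul_le_mul_of_nonneg_left
    (measureReal_mono ?_ (measure_ne_top _ _)) (Real.exp_pos _).le) (Real.exp_pos _).le
  rintro A ⟨⟨w, hw, hA⟩, hAR⟩
  have hwc := hcov hw
  simp only [Set.mem_iUnion] at hwc
  obtain ⟨y, hy, hwy⟩ := hwc
  refine ⟨⟨y, hy⟩, ?_⟩
  have h1 : ∀ i, |∑ j, A (i, j) * y j| ≤ n * R * r := by
    intro i
    have e : ∑ j, A (i, j) * y j = ∑ j, A (i, j) * (y j - w j) := by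
      simp only [mul_sub, Finset.sum_sub_distrib, hA i, sub_zero]
    rw [e]
    refine (Finset.abs_sum_le_sum_abs _ _).trans ?_
    have : ∀ j ∈ Finset.univ, |A (i, j) * (y j - w j)| ≤ R * r := by
      intro j _
      rw [abs_mul]
      refine mul_le_mul (hAR _) ?_ (abs_nonneg _) hR.le
      have := dist_le_pi_dist w y j
      rw [Real.dist_eq, abs_sub_comm] at this
      exact this.trans (Metric.mem_ball.1 hwy).le
    refine (Finset.sum_le_sum this).trans ?_
    simp [mul_assoc]
  have h2 : ∑ i, (∑ j, A (i, j) * y j) ^ 2 ≤ ∑ i : Fin m, (n * R * r) ^ 2 :=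
    Finset.sum_le_sum fun i _ => sq_le_sq' (abs_le.1 (h1 i)).1 (abs_le.1 (h1 i)).2
  refine h2.trans ?_
  simp only [Finset.sum_const, Finset.card_univ, Fintype.card_fin, nsmul_eq_mul]
  have h3 : (m + 1) * ((n * R + 1) * r) = τ := by rw [hr]; field_simp
  rw [← h3]
  have hm : (0:ℝ) ≤ m := Nat.cast_nonneg m
  have hn : (0:ℝ) ≤ n * R := by positivity
  have h4 : (n * R * r) ^ 2 ≤ ((n * R + 1) * r) ^ 2 := by gcongr; linarith
  calc (m:ℝ) * (n * R * r) ^ 2 ≤ (m + 1) ^ 2 * ((n * R + 1) * r) ^ 2 := by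
        refine mul_le_mul ?_ h4 (sq_nonneg _) (sq_nonneg _)
        nlinarith
    _ = _ := by ring

theorem gordon_set {m n : ℕ} (S : Set (Fin n → ℝ)) (hS : ∀ w ∈ S, ∑ j, w j ^ 2 = 1)
    {C : ℝ} (hC : 0 < C)
    (U : (Option (Fin m ⊕ Fin n) → ℝ) → ℝ) (hU : Integrable U (gD _))
    (hUb : ∀ w ∈ S, ∀ x, Real.exp (C * (∑ j, w j * x (some (Sum.inr j))
      - Real.sqrt (∑ i, x (some (Sum.inl i)) ^ 2))) ≤ U x) :
    gD (Fin m × Fin n) {A | ∃ w ∈ S, ∀ i, ∑ j, A (i, j) * w j = 0}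
      ≤ ENNReal.ofReal (Real.exp (-(C ^ 2 / 2)) * ∫ x, U x ∂(gD _)) := by
  rcases S.eq_empty_or_nonempty with rfl | hne
  · simp
  have hR : ∀ R : ℝ, 0 < R → 
      (gD (Fin m × Fin n)).real {A | (∃ w ∈ S, ∀ i, ∑ j, A (i, j) * w j = 0) ∧ ∀ d, |A d| ≤ R}
        ≤ Real.exp (-(C ^ 2 / 2)) * ∫ x, U x ∂(gD _) := by
    intro R hR
    set q := (gD (Fin m × Fin n)).real {A | (∃ w ∈ S, ∀ i, ∑ j, A (i, j) * w j = 0) ∧ ∀ d, |A d| ≤ R}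
    have hlim : Filter.Tendsto (fun τ : ℝ => Real.exp (C ^ 2 / 2) * (Real.exp (-(2 * C * τ)) * q))
        (nhdsWithin 0 (Set.Ioi 0)) (nhds (Real.exp (C ^ 2 / 2) * (Real.exp (-(2 * C * 0)) * q))) := by
      refine (Continuous.tendsto ?_ 0).mono_left nhdsWithin_le_nhds
      fun_prop
    have := le_of_tendsto hlim (Filter.eventually_of_mem self_mem_nhdsWithin fun τ hτ =>
      gordon_set_R S hS hne hC hτ hR U hU hUb)
    simp only [mul_zero, neg_zero, Real.exp_zero, one_mul] at this
    rw [Real.exp_neg]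
    rw [inv_mul_eq_div, le_div_iff₀ (Real.exp_pos _), mul_comm]
    exact this
  have hun : {A : Fin m × Fin n → ℝ | ∃ w ∈ S, ∀ i, ∑ j, A (i, j) * w j = 0}
      = ⋃ N : ℕ, {A | (∃ w ∈ S, ∀ i, ∑ j, A (i, j) * w j = 0) ∧ ∀ d, |A d| ≤ (N : ℝ) + 1} := by
    ext A
    simp only [Set.mem_iUnion]
    constructor
    · intro hA
      obtain ⟨N, hN⟩ := exists_nat_ge ‖A‖
      exact ⟨N, hA, fun d => (norm_le_pi_norm A d).trans (by linarith)⟩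
    · rintro ⟨N, hA, -⟩
      exact hA
  rw [hun, Monotone.measure_iUnion]
  · refine iSup_le fun N => ?_
    rw [← ENNReal.ofReal_toReal (measure_ne_top (gD (Fin m × Fin n)) _)]
    exact ENNReal.ofReal_le_ofReal (hR _ (by positivity))
  · rintro a b hab A ⟨hA, h2⟩
    refine ⟨hA, fun d => (h2 d).trans ?_⟩
    have : (a:ℝ) ≤ b := by exact_mod_cast hab
    linarith

lemma mp_uncurry (m n : ℕ) : MeasurePreserving (fun (A : Fin m → Fin n → ℝ) (d : Fin m × Fin n) => A d.1 d.2)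
    (Measure.pi fun _ : Fin m => Measure.pi fun _ : Fin n => g1) (gD (Fin m × Fin n)) := by
  have hm : Measurable (fun (A : Fin m → Fin n → ℝ) (d : Fin m × Fin n) => A d.1 d.2) := by
    fun_prop
  refine ⟨hm, ?_⟩
  symm
  refine Measure.pi_eq fun s hs => ?_
  rw [Measure.map_apply hm (MeasurableSet.univ_pi hs)]
  have : (fun (A : Fin m → Fin n → ℝ) (d : Fin m × Fin n) => A d.1 d.2) ⁻¹' (Set.univ.pi s)
      = Set.univ.pi fun i => Set.univ.pi fun j => s (i, j) := by
    ext A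
    simp only [Set.mem_preimage, Set.mem_univ_pi, Prod.forall]
  rw [this, Measure.pi_pi]
  simp only [Measure.pi_pi, Fintype.prod_prod_type]

end GI

open MeasureTheory ProbabilityTheory
namespace GI

lemma gauss_sq {l : ℝ} (hl : 0 ≤ l) :
    ∫ s, Real.exp (-l * s ^ 2) ∂g1 = Real.exp (-(1 / 2) * Real.log (1 + 2 * l)) := by
  rw [g1, integral_gaussianReal_eq_integral_smul one_ne_zero]
  have e : ∀ x : ℝ, gaussianPDFReal 0 1 x • Real.exp (-l * x ^ 2)
      = (Real.sqrt (2 * Real.pi))⁻¹ * Real.exp (-(1 / 2 + l) * x ^ 2) := by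
    intro x
    simp only [gaussianPDFReal, smul_eq_mul, NNReal.coe_one, mul_one, sub_zero]
    rw [mul_assoc, ← Real.exp_add]
    congr 2
    ring
  simp_rw [e]
  rw [integral_const_mul, integral_gaussian, ← Real.sqrt_inv, ← Real.sqrt_mul (by positivity)]
  have e2 : (2 * Real.pi)⁻¹ * (Real.pi / (1 / 2 + l)) = (1 + 2 * l)⁻¹ := by
    have := Real.pi_pos
    field_simp
  rw [e2, Real.sqrt_inv, neg_mul, Real.exp_neg, mul_comm (1 / 2 : ℝ), Real.exp_mul,
    Real.exp_log (by positivity), Real.sqrt_eq_rpow]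

lemma gaussD_sq {m : ℕ} {l : ℝ} (hl : 0 ≤ l) :
    ∫ x : Fin m → ℝ, Real.exp (-l * ∑ i, x i ^ 2) ∂(gD (Fin m))
      = Real.exp (-(m / 2) * Real.log (1 + 2 * l)) := by
  have e : ∀ x : Fin m → ℝ, Real.exp (-l * ∑ i, x i ^ 2) = ∏ i, Real.exp (-l * x i ^ 2) := by
    intro x
    rw [Finset.mul_sum, Real.exp_sum]
  simp_rw [e]
  have := integral_fintype_prod_eq_prod (μ := fun _ : Fin m => g1) (fun (_ : Fin m) (s : ℝ) => Real.exp (-l * s ^ 2))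
  refine this.trans ?_
  simp only [gauss_sq hl, Finset.prod_const, Finset.card_univ, Fintype.card_fin]
  rw [← Real.exp_nat_mul]
  congr 1
  ring

lemma gaussD_sq_int {m : ℕ} {l : ℝ} (hl : 0 ≤ l) :
    Integrable (fun x : Fin m → ℝ => Real.exp (-l * ∑ i, x i ^ 2)) (gD (Fin m)) := by
  refine Integrable.of_bound (C := 1) (Continuous.aestronglyMeasurable (by fun_prop)) (Filter.Eventually.of_forall fun x => ?_)
  rw [Real.norm_eq_abs, abs_of_pos (Real.exp_pos _), Real.exp_le_one_iff]
  have : 0 ≤ ∑ i, x i ^ 2 := Finset.sum_nonneg fun _ _ => sq_nonneg _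
  nlinarith

lemma sph_form {c α : ℝ} (hc : 0 < c) (hα : 0 < α) : ∃ ρ : ℝ, 0 < ρ ∧ ρ ^ 2 + c * ρ = α ∧
    c * Isph c α = -c * ρ / 2 - α / 2 * Real.log α + α * Real.log ρ := by
  set s := Real.sqrt (c ^ 2 + 4 * α) with hs
  have hs2 : s ^ 2 = c ^ 2 + 4 * α := Real.sq_sqrt (by positivity)
  have hs0 : 0 ≤ s := Real.sqrt_nonneg _
  have hsc : c < s := by nlinarith
  have hρ : 0 < (s - c) / 2 := by linarith
  have e1 : ((s - c) / 2) ^ 2 + c * ((s - c) / 2) = α := by nlinarith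
  refine ⟨(s - c) / 2, hρ, e1, ?_⟩
  have h4 : Real.sqrt (4 * c ^ 2 + 16 * α) = 2 * s := by
    rw [show 4 * c ^ 2 + 16 * α = (2 * s) ^ 2 by rw [mul_pow, hs2]; ring, Real.sqrt_sq (by positivity)]
  unfold Isph
  simp only [h4]
  set ρ := (s - c) / 2 with hρd
  have e2 : (2 * c - 2 * s) / 8 = -ρ / 2 := by rw [hρd]; ring
  rw [e2]
  have e3 : 1 - c / (2 * (-ρ / 2)) = α / ρ ^ 2 := by
    rw [← e1]; field_simp; ring
  rw [e3, Real.log_div hα.ne' (by positivity), Real.log_pow]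
  push_cast
  field_simp
  ring

lemma sph_pt {c α : ℝ} (hc : 0 < c) (hα : 0 < α) (r : ℝ) (hr : 0 < r) :
    ∃ l : ℝ, 0 ≤ l ∧ -c * r + l * r ^ 2 - α / 2 * Real.log (1 + 2 * l) ≤ c * Isph c α := by
  have main : ∀ r : ℝ, 0 < r → -c * r + (α - r ^ 2) / 2 - α / 2 * Real.log (α / r ^ 2) ≤ c * Isph c α := by
    intro r hr
    obtain ⟨ρ, hρ, h1, h2⟩ := sph_form hc hα
    rw [h2, Real.log_div hα.ne' (by positivity), Real.log_pow]
    have h3 := Real.log_le_sub_one_of_pos (div_pos hr hρ)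
    rw [Real.log_div hr.ne' hρ.ne'] at h3
    have h4 := mul_le_mul_of_nonneg_left h3 hα.le
    have h5 : α * (r / ρ - 1) = ρ * r + c * r - α := by rw [← h1]; field_simp
    rw [h5] at h4
    push_cast
    nlinarith [sq_nonneg (r - ρ)]
  by_cases h : r ^ 2 ≤ α
  · refine ⟨(α / r ^ 2 - 1) / 2, ?_, ?_⟩
    · have : 1 ≤ α / r ^ 2 := by rw [le_div_iff₀ (by positivity)]; linarith
      linarith
    · have e1 : 1 + 2 * ((α / r ^ 2 - 1) / 2) = α / r ^ 2 := by ring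
      have e2 : (α / r ^ 2 - 1) / 2 * r ^ 2 = (α - r ^ 2) / 2 := by field_simp
      rw [e1, e2]; exact main r hr
  · refine ⟨0, le_rfl, ?_⟩
    have h1 := main (Real.sqrt α) (Real.sqrt_pos.2 hα)
    rw [Real.sq_sqrt hα.le, div_self hα.ne'] at h1
    simp only [sub_self, zero_div, Real.log_one, mul_zero, sub_zero, add_zero] at h1
    simp only [mul_zero, add_zero, zero_mul, Real.log_one, sub_zero]
    have h2 : Real.sqrt α ≤ r := Real.sqrt_le_iff.2 ⟨hr.le, by linarith⟩
    nlinarith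

theorem sph_bound {c α Δ : ℝ} (hc : 0 < c) (hα : 0 < α) (hΔ : 0 < Δ) :
    ∃ J : ℕ, ∀ m n : ℕ, 0 < n → α * n ≤ m → ∃ V : (Fin m → ℝ) → ℝ, Integrable V (gD (Fin m)) ∧
      (∀ x, Real.exp (-(c * Real.sqrt n * Real.sqrt (∑ i, x i ^ 2))) ≤ V x) ∧
      ∫ x, V x ∂(gD (Fin m)) ≤ (J + 1) * Real.exp (n * (c * (Isph c α + Δ))) := by
  obtain ⟨J, hJ⟩ := exists_nat_ge (-Isph c α / Δ)
  rw [div_le_iff₀ hΔ] at hJ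
  choose! l hl0 hl using sph_pt hc hα
  refine ⟨J, fun m n hn hmn => ?_⟩
  have hn' : (0:ℝ) < n := by exact_mod_cast hn
  set rr : ℕ → ℝ := fun j => ((j:ℝ) + 1) * Δ with hrr
  have hrr0 : ∀ j, 0 < rr j := fun j => by simp only [hrr]; positivity
  refine ⟨fun x => (∑ j ∈ Finset.range J, Real.exp (n * (-c * (j * Δ) + l (rr j) * rr j ^ 2)) *
    Real.exp (-l (rr j) * ∑ i, x i ^ 2)) + Real.exp (-(c * n * (J * Δ))), ?_, ?_, ?_⟩
  · refine Integrable.add (integrable_finsetSum _ fun j _ => ?_) (integrable_const _)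
    exact (gaussD_sq_int (hl0 _ (hrr0 j))).const_mul _
  · intro x
    set q := ∑ i, x i ^ 2 with hq
    have hq0 : 0 ≤ q := Finset.sum_nonneg fun _ _ => sq_nonneg _
    set R := Real.sqrt (q / n) with hR
    have hR0 : 0 ≤ R := Real.sqrt_nonneg _
    have hR2 : q = n * R ^ 2 := by
      rw [hR, Real.sq_sqrt (by positivity)]; field_simp
    have e : c * Real.sqrt n * Real.sqrt q = c * n * R := by
      rw [hR2, Real.sqrt_mul hn'.le, Real.sqrt_sq hR0]
      have := Real.mul_self_sqrt hn'.le
      linear_combination (c * R) * this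
    rw [e]
    have hs0 : ∀ j ∈ Finset.range J, 0 ≤ Real.exp (n * (-c * (j * Δ) + l (rr j) * rr j ^ 2)) *
      Real.exp (-l (rr j) * q) := fun j _ => by positivity
    by_cases hRJ : J * Δ ≤ R
    · have h1 : Real.exp (-(c * n * R)) ≤ Real.exp (-(c * n * (J * Δ))) := by
        refine Real.exp_le_exp.2 (neg_le_neg ?_)
        gcongr
      have := Finset.sum_nonneg hs0
      linarith
    · push Not at hRJ
      set j := ⌊R / Δ⌋₊ with hj
      have h1 : (j:ℝ) * Δ ≤ R := by
        rw [← le_div_iff₀ hΔ]; exact Nat.floor_le (by positivity)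
      have h2 : R < ((j:ℝ) + 1) * Δ := by
        rw [← div_lt_iff₀ hΔ]; exact Nat.lt_floor_add_one _
      have hjJ : j < J := by
        have : (j:ℝ) < J := by
          have := h1.trans_lt hRJ
          exact lt_of_mul_lt_mul_right this hΔ.le
        exact_mod_cast this
      have h3 := Finset.single_le_sum hs0 (Finset.mem_range.2 hjJ)
      have h4 : Real.exp (-(c * n * R)) ≤ Real.exp (n * (-c * (j * Δ) + l (rr j) * rr j ^ 2)) *
          Real.exp (-l (rr j) * q) := by
        rw [← Real.exp_add]
        refine Real.exp_le_exp.2 ?_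
        rw [hR2]
        have h5 : 0 ≤ l (rr j) * (rr j ^ 2 - R ^ 2) := by
          refine mul_nonneg (hl0 _ (hrr0 j)) ?_
          have : R ≤ rr j := h2.le
          nlinarith
        have h6 := mul_le_mul_of_nonneg_left h1 (mul_nonneg hc.le hn'.le)
        have h7 := mul_nonneg hn'.le h5
        nlinarith
      have := (Real.exp_pos (-(c * n * (J * Δ)))).le
      linarith
  · rw [integral_add (integrable_finsetSum _ fun j _ => (gaussD_sq_int (hl0 _ (hrr0 j))).const_mul _)
      (integrable_const _), integral_finsetSum _ fun j _ => (gaussD_sq_int (hl0 _ (hrr0 j))).const_mul _]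
    simp only [integral_const_mul, integral_const, probReal_univ, one_smul]
    have h1 : ∀ j ∈ Finset.range J, Real.exp (n * (-c * (j * Δ) + l (rr j) * rr j ^ 2)) *
        ∫ x : Fin m → ℝ, Real.exp (-l (rr j) * ∑ i, x i ^ 2) ∂(gD (Fin m))
          ≤ Real.exp (n * (c * (Isph c α + Δ))) := by
      intro j _
      have h0 := hl0 _ (hrr0 j)
      rw [gaussD_sq h0, ← Real.exp_add]
      refine Real.exp_le_exp.2 ?_
      have h2 : 0 ≤ Real.log (1 + 2 * l (rr j)) := Real.log_nonneg (by linarith)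
      have h3 := mul_le_mul_of_nonneg_right hmn h2
      have h4 := mul_le_mul_of_nonneg_left (hl _ (hrr0 j)) hn'.le
      have h5 : rr j = j * Δ + Δ := by simp only [hrr]; ring
      have h6 : n * (-c * rr j) = n * (-c * (j * Δ)) - n * (c * Δ) := by rw [h5]; ring
      nlinarith
    have h2 : Real.exp (-(c * n * (J * Δ))) ≤ Real.exp (n * (c * (Isph c α + Δ))) := by
      refine Real.exp_le_exp.2 ?_
      have : -(c * n * (J * Δ)) = n * (c * -(J * Δ)) := by ring
      rw [this]
      gcongr
      linarith
    have h3 := Finset.sum_le_sum h1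
    rw [Finset.sum_const, Finset.card_range, nsmul_eq_mul] at h3
    linarith

end GI

open MeasureTheory ProbabilityTheory
namespace GI

lemma mp_some (D : Type*) [Fintype D] : MeasurePreserving (fun (x : Option D → ℝ) (d : D) => x (some d))
    (gD (Option D)) (gD D) := by
  have hm : Measurable (fun (x : Option D → ℝ) (d : D) => x (some d)) := by fun_prop
  refine ⟨hm, ?_⟩
  symm
  refine Measure.pi_eq fun s hs => ?_
  rw [Measure.map_apply hm (MeasurableSet.univ_pi hs)]
  have : (fun (x : Option D → ℝ) (d : D) => x (some d)) ⁻¹' (Set.univ.pi s)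
      = Set.univ.pi fun o : Option D => o.elim Set.univ s := by
    ext A
    simp [Option.forall]
  rw [this, gD, Measure.pi_pi, Fintype.prod_option]
  simp

lemma int_option_split {D1 D2 : Type*} [Fintype D1] [Fintype D2] {G1 : (D1 → ℝ) → ℝ}
    {G2 : (D2 → ℝ) → ℝ} (h1 : Integrable G1 (gD D1)) (h2 : Integrable G2 (gD D2)) :
    Integrable (fun x : Option (D1 ⊕ D2) → ℝ =>
        G1 (fun d => x (some (Sum.inl d))) * G2 (fun d => x (some (Sum.inr d)))) (gD _) ∧
    ∫ x : Option (D1 ⊕ D2) → ℝ, 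
        G1 (fun d => x (some (Sum.inl d))) * G2 (fun d => x (some (Sum.inr d))) ∂(gD _)
      = (∫ x, G1 x ∂(gD D1)) * ∫ x, G2 x ∂(gD D2) := by
  have hF : Integrable (fun x : D1 ⊕ D2 → ℝ => G1 (fun d => x (Sum.inl d)) * G2 (fun d => x (Sum.inr d)))
      (gD (D1 ⊕ D2)) :=
    (measurePreserving_sumPiEquivProdPi (X := fun _ : D1 ⊕ D2 => ℝ)
      (fun _ : D1 ⊕ D2 => g1)).integrable_comp_of_integrable (h1.mul_prod h2)
  have mp := mp_some (D1 ⊕ D2)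
  refine ⟨mp.integrable_comp_of_integrable hF, ?_⟩
  rw [← integral_split]
  rw [← mp.map_eq] at hF
  have := integral_map mp.measurable.aemeasurable hF.aestronglyMeasurable
  rw [mp.map_eq] at this
  exact this.symm

noncomputable def tp (γ ν₁ ν₂ s : ℝ) : ℝ :=
  max ((s - ν₁) ^ 2 / (4 * γ) - ν₂) ((max (s - ν₁) 0) ^ 2 / (4 * γ) + ν₂)

lemma exp_sq_int {a ν : ℝ} (ha : a < 1 / 2) : Integrable (fun s => Real.exp (a * (s - ν) ^ 2)) g1 := by
  rw [integrable_g1_iff]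
  set b := 1 / 2 - a with hb
  have hb0 : 0 < b := by linarith
  have h1 := ((integrable_exp_neg_mul_sq (half_pos hb0)).const_mul
    ((Real.sqrt (2 * Real.pi))⁻¹ * Real.exp (2 * a ^ 2 * ν ^ 2 / b + a * ν ^ 2)))
  refine h1.mono' (by
    refine Measurable.aestronglyMeasurable ?_
    fun_prop) (Filter.Eventually.of_forall fun s => ?_)
  rw [Real.norm_eq_abs, abs_of_nonneg (mul_nonneg (gaussianPDFReal_nonneg _ _ _) (Real.exp_pos _).le)]
  simp only [gaussianPDFReal, NNReal.coe_one, mul_one, sub_zero]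
  rw [mul_assoc, mul_assoc, ← Real.exp_add, ← Real.exp_add]
  refine mul_le_mul_of_nonneg_left (Real.exp_le_exp.2 ?_) (by positivity)
  have h2 : 0 ≤ b / 2 * (s + 2 * a * ν / b) ^ 2 := by positivity
  have h3 : b / 2 * (s + 2 * a * ν / b) ^ 2 = b / 2 * s ^ 2 + 2 * a * ν * s + 2 * a ^ 2 * ν ^ 2 / b := by
    field_simp; ring
  rw [h3] at h2
  have h4 : a = 1 / 2 - b := by rw [hb]; ring
  have h5 : -s ^ 2 / (2:ℝ) + a * (s - ν) ^ 2 = - b * s ^ 2 - 2 * a * ν * s + a * ν ^ 2 := by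
    rw [hb]; ring
  rw [h5]
  linarith

lemma tp_cont (γ ν₁ ν₂ : ℝ) : Continuous (tp γ ν₁ ν₂) := by
  unfold tp; fun_prop

lemma tp_int {c γ ν₁ ν₂ : ℝ} (hc : 0 < c) (hγ : c / 2 < γ) (h2 : 0 ≤ ν₂) :
    Integrable (fun s => Real.exp (c * tp γ ν₁ ν₂ s)) g1 := by
  have hγ0 : 0 < γ := by linarith
  have ha : c / (4 * γ) < 1 / 2 := by rw [div_lt_div_iff₀ (by positivity) (by norm_num)]; linarith
  refine ((exp_sq_int (ν := ν₁) ha).mul_const (Real.exp (c * ν₂))).mono'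
    ((by have := tp_cont γ ν₁ ν₂; fun_prop : Continuous _).aestronglyMeasurable)
    (Filter.Eventually.of_forall fun s => ?_)
  rw [Real.norm_eq_abs, abs_of_pos (Real.exp_pos _), ← Real.exp_add]
  refine Real.exp_le_exp.2 ?_
  have e : c / (4 * γ) * (s - ν₁) ^ 2 + c * ν₂ = c * ((s - ν₁) ^ 2 / (4 * γ) + ν₂) := by ring
  rw [e]
  refine mul_le_mul_of_nonneg_left ?_ hc.le
  unfold tp
  refine max_le (by linarith) ?_
  have h5 : max (s - ν₁) 0 ^ 2 ≤ (s - ν₁) ^ 2 := by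
    rw [← sq_abs (s - ν₁)]
    exact pow_le_pow_left₀ (le_max_right _ _) (max_le (le_abs_self _) (abs_nonneg _)) 2
  have h6 := div_le_div_of_nonneg_right h5 (show 0 ≤ 4 * γ by positivity)
  linarith

lemma tp_pt {n : ℕ} {γ ν₁ ν₂ : ℝ} (hγ : 0 < γ) (h1 : 0 ≤ ν₁) (h2 : 0 ≤ ν₂)
    (w h : Fin n → ℝ) (hw : ∑ j, w j ^ 2 = 1) (hs : ∑ j, w j ≤ 0) (K : Finset (Fin n)) (k : ℝ)
    (hK : (K.card : ℝ) ≤ k) (hpos : ∀ i ∉ K, 0 ≤ w i) :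
    Real.sqrt n * ∑ j, w j * h j ≤ n * γ + ∑ j, tp γ ν₁ ν₂ (h j) + ν₂ * (2 * k - n) := by
  classical
  set q := Real.sqrt n with hq
  have hq0 : 0 ≤ q := Real.sqrt_nonneg _
  have hq2 : q ^ 2 = n := Real.sq_sqrt (Nat.cast_nonneg _)
  have young : ∀ u v : ℝ, q * (u * v) ≤ u ^ 2 / (4 * γ) + n * γ * v ^ 2 := by
    intro u v
    rw [← hq2]
    have : 0 ≤ (u / (2 * γ) - q * v) ^ 2 * γ := by positivity
    have e : (u / (2 * γ) - q * v) ^ 2 * γ = u ^ 2 / (4 * γ) + q ^ 2 * γ * v ^ 2 - q * (u * v) := by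
      field_simp; ring
    linarith
  have hpt : ∀ j ∈ Finset.univ, q * ((h j - ν₁) * w j) ≤
      n * γ * w j ^ 2 + tp γ ν₁ ν₂ (h j) + ((if j ∈ K then 2 * ν₂ else 0) - ν₂) := by
    intro j _
    by_cases hj : j ∈ K
    · rw [if_pos hj]
      have := young (h j - ν₁) (w j)
      have h3 : (h j - ν₁) ^ 2 / (4 * γ) - ν₂ ≤ tp γ ν₁ ν₂ (h j) := le_max_left _ _
      linarith
    · rw [if_neg hj]
      have := young (max (h j - ν₁) 0) (w j)
      have h3 : max (h j - ν₁) 0 ^ 2 / (4 * γ) + ν₂ ≤ tp γ ν₁ ν₂ (h j) := le_max_right _ _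
      have h4 : q * ((h j - ν₁) * w j) ≤ q * (max (h j - ν₁) 0 * w j) :=
        mul_le_mul_of_nonneg_left (mul_le_mul_of_nonneg_right (le_max_left _ _) (hpos j hj)) hq0
      linarith
  have hsum := Finset.sum_le_sum hpt
  rw [← Finset.mul_sum, Finset.sum_add_distrib, Finset.sum_add_distrib, ← Finset.mul_sum, hw,
    Finset.sum_sub_distrib] at hsum
  have e1 : ∑ j, (h j - ν₁) * w j = ∑ j, w j * h j - ν₁ * ∑ j, w j := by
    rw [Finset.mul_sum, ← Finset.sum_sub_distrib]
    exact Finset.sum_congr rfl fun j _ => by ring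
  have e2 : ∑ j, (if j ∈ K then 2 * ν₂ else 0) = K.card * (2 * ν₂) := by
    simp
  have e3 : ∑ _j : Fin n, ν₂ = n * ν₂ := by simp
  rw [e1, e2, e3] at hsum
  have h5 : q * (ν₁ * ∑ j, w j) ≤ 0 :=
    mul_nonpos_of_nonneg_of_nonpos hq0 (mul_nonpos_of_nonneg_of_nonpos h1 hs)
  have h6 : (K.card : ℝ) * (2 * ν₂) ≤ k * (2 * ν₂) := by gcongr
  rw [mul_sub] at hsum
  linarith

/-- the cone section -/
def Scone (n k : ℕ) : Set (Fin n → ℝ) :=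
  {w | ∑ j, w j ^ 2 = 1 ∧ ∑ j, w j ≤ 0 ∧ ∃ K : Finset (Fin n), K.card ≤ k ∧ ∀ i ∉ K, 0 ≤ w i}

theorem prob_bound {c α γ ν₁ ν₂ Δ : ℝ} (hc : 0 < c) (hα : 0 < α) (hΔ : 0 < Δ) (hγ : c / 2 < γ)
    (h1 : 0 ≤ ν₁) (h2 : 0 ≤ ν₂) :
    ∃ J : ℕ, ∀ m n k : ℕ, 0 < n → α * n ≤ m →
      gD (Fin m × Fin n) {A | ∃ w ∈ Scone n k, ∀ i, ∑ j, A (i, j) * w j = 0}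
        ≤ ENNReal.ofReal (Real.exp (-(c ^ 2 * n / 2)) * ((J + 1) * Real.exp (n * (c * (Isph c α + Δ))) *
          (Real.exp (c * (n * γ + ν₂ * (2 * k - n))) * IexpPlus c γ ν₁ ν₂ ^ n))) := by
  obtain ⟨J, hJ⟩ := sph_bound hc hα hΔ
  refine ⟨J, fun m n k hn hmn => ?_⟩
  obtain ⟨V, hV, hVb, hVi⟩ := hJ m n hn hmn
  have hn' : (0:ℝ) < n := by exact_mod_cast hn
  set G2 : (Fin n → ℝ) → ℝ := fun h => Real.exp (c * (n * γ + ν₂ * (2 * k - n))) *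
    ∏ j, Real.exp (c * tp γ ν₁ ν₂ (h j)) with hG2
  have iG2 : Integrable G2 (gD (Fin n)) :=
    (Integrable.fintype_prod (μ := fun _ : Fin n => g1)
      (f := fun _ s => Real.exp (c * tp γ ν₁ ν₂ s)) fun _ => tp_int hc hγ h2).const_mul _
  have eG2 : ∫ h, G2 h ∂(gD (Fin n)) = Real.exp (c * (n * γ + ν₂ * (2 * k - n))) * IexpPlus c γ ν₁ ν₂ ^ n := by
    simp only [hG2]
    rw [integral_const_mul]
    congr 1
    refine (integral_fintype_prod_eq_prod (μ := fun _ : Fin n => g1)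
      (fun _ s => Real.exp (c * tp γ ν₁ ν₂ s))).trans ?_
    simp only [Finset.prod_const, Finset.card_univ, Fintype.card_fin]
    rfl
  obtain ⟨iU, eU⟩ := int_option_split hV iG2
  have hI : 0 ≤ IexpPlus c γ ν₁ ν₂ := integral_nonneg fun _ => (Real.exp_pos _).le
  refine (gordon_set (m := m) (Scone n k) (fun w hw => hw.1) (C := c * Real.sqrt n) (by positivity)
    _ iU ?_).trans (ENNReal.ofReal_le_ofReal ?_)
  · rintro w ⟨hw1, hw2, K, hK, hK2⟩ x
    have h3 := tp_pt (show 0 < γ by linarith) h1 h2 w (fun j => x (some (Sum.inr j))) hw1 hw2 K k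
      (by exact_mod_cast hK) hK2
    have h4 := mul_le_mul_of_nonneg_left h3 hc.le
    have h5 : Real.exp (c * Real.sqrt n * ∑ j, w j * x (some (Sum.inr j))) ≤
        G2 (fun d => x (some (Sum.inr d))) := by
      simp only [hG2]
      rw [← Real.exp_sum, ← Real.exp_add]
      refine Real.exp_le_exp.2 ?_
      rw [← Finset.mul_sum]
      linarith
    rw [mul_sub, sub_eq_neg_add, Real.exp_add]
    exact mul_le_mul (hVb _) h5 (Real.exp_pos _).le ((Real.exp_pos _).le.trans (hVb _))
  · rw [eU, eG2, mul_pow, Real.sq_sqrt hn'.le]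
    gcongr

end GI

open MeasureTheory ProbabilityTheory
namespace GI

lemma bad_subset {m n k : ℕ} (A : Fin m → Fin n → ℝ)
    (hA : ¬ ∃ w ∈ Scone n k, ∀ i, ∑ j, A i j * w j = 0) (x : Fin n → ℝ) (hx : ∀ i, 0 ≤ x i)
    (hK : ∃ K : Finset (Fin n), K.card ≤ k ∧ ∀ i ∉ K, x i = 0) : UniqueL1MinNonneg A x := by
  intro z hz hz0 hne
  by_contra hcon
  push Not at hcon
  apply hA
  obtain ⟨K, hKc, hKx⟩ := hK
  obtain ⟨i0, hi0⟩ := Function.ne_iff.1 hne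
  set q := ∑ j, (z j - x j) ^ 2 with hq
  have hq0 : 0 < q := by
    refine Finset.sum_pos' (fun _ _ => sq_nonneg _) ⟨i0, Finset.mem_univ _, ?_⟩
    have := sub_ne_zero.2 hi0
    positivity
  have hs : 0 < Real.sqrt q := Real.sqrt_pos.2 hq0
  simp only [abs_of_nonneg (hx _), abs_of_nonneg (hz0 _)] at hcon
  refine ⟨fun j => (z j - x j) / Real.sqrt q, ⟨?_, ?_, K, hKc, fun i hi => ?_⟩, fun i => ?_⟩
  · simp only [div_pow, Real.sq_sqrt hq0.le]
    rw [← Finset.sum_div, ← hq, div_self hq0.ne']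
  · rw [← Finset.sum_div, Finset.sum_sub_distrib]
    exact div_nonpos_of_nonpos_of_nonneg (by linarith) hs.le
  · simp only [hKx i hi, sub_zero]
    exact div_nonneg (hz0 i) hs.le
  · have e : ∀ j, A i j * ((z j - x j) / Real.sqrt q) = (A i j * z j - A i j * x j) / Real.sqrt q := by
      intro j; ring
    simp only [e]
    rw [← Finset.sum_div, Finset.sum_sub_distrib, hz i, sub_self, zero_div]

theorem main_aux (α β : ℝ) (hα : α ∈ Set.Ioo (0 : ℝ) 1) (hβ : β ∈ Set.Ioo (0 : ℝ) 1)
    (hcond : ∃ c : ℝ, 0 < c ∧ -c / 2 + IstrPlus c β + Isph c α < 0) :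
    ∃ ε > (0 : ℝ), ∃ N : ℕ, ∀ n ≥ N,
      gD (Fin ⌈α * n⌉₊ × Fin n) {A | ∃ w ∈ Scone n ⌈β * n⌉₊, ∀ i, ∑ j, A (i, j) * w j = 0}
        ≤ ENNReal.ofReal (Real.exp (-ε * n)) := by
  obtain ⟨c, hc, hcond⟩ := hcond
  have hlt : IstrPlus c β < c / 2 - Isph c α := by linarith
  unfold IstrPlus at hlt
  have hne : {v : ℝ | ∃ γ ν₁ ν₂ : ℝ, c / 2 < γ ∧ 0 ≤ ν₁ ∧ 0 ≤ ν₂ ∧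
      v = ν₂ * (2 * β - 1) + γ + (1 / c) * Real.log (IexpPlus c γ ν₁ ν₂)}.Nonempty :=
    ⟨_, c, 0, 0, by linarith, le_rfl, le_rfl, rfl⟩
  obtain ⟨v, ⟨γ, ν₁, ν₂, hγ, h1, h2, hv⟩, hvlt⟩ := exists_lt_of_csInf_lt hne hlt
  have hI : 0 < IexpPlus c γ ν₁ ν₂ := integral_exp_pos (tp_int hc hγ h2)
  set κ := c / 2 - Isph c α - v with hκ
  have hκ0 : 0 < κ := by linarith
  obtain ⟨J, hJ⟩ := prob_bound (ν₁ := ν₁) hc hα.1 (half_pos hκ0) hγ h1 h2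
  set ε := c * κ / 4 with hε
  have hε0 : 0 < ε := by positivity
  set M : ℝ := (J + 1) * Real.exp (2 * c * ν₂) with hM
  have hM0 : 0 < M := by positivity
  obtain ⟨N, hN⟩ := exists_nat_ge (Real.log M / ε)
  refine ⟨ε, hε0, N + 1, fun n hn => ?_⟩
  have hn0 : 0 < n := by omega
  have hn' : (0:ℝ) < n := by exact_mod_cast hn0
  refine (hJ ⌈α * n⌉₊ n ⌈β * n⌉₊ hn0 (Nat.le_ceil _)).trans (ENNReal.ofReal_le_ofReal ?_)
  have hk : (⌈β * n⌉₊ : ℝ) ≤ β * n + 1 := (Nat.ceil_lt_add_one (by have := hβ.1; positivity)).le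
  set k : ℝ := (⌈β * n⌉₊ : ℝ) with hkd
  have hMn : M ≤ Real.exp (ε * n) := by
    rw [← Real.log_le_iff_le_exp hM0]
    rw [div_le_iff₀ hε0] at hN
    have : (N:ℝ) ≤ n := by exact_mod_cast (by omega : N ≤ n)
    nlinarith
  have e1 : IexpPlus c γ ν₁ ν₂ ^ n = Real.exp (n * Real.log (IexpPlus c γ ν₁ ν₂)) := by
    rw [Real.exp_nat_mul, Real.exp_log hI]
  have e2 : Real.log (IexpPlus c γ ν₁ ν₂) = c * (v - ν₂ * (2 * β - 1) - γ) := by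
    rw [hv]; field_simp; ring
  rw [e1, e2]
  have h3 : c * (n * γ + ν₂ * (2 * k - n)) ≤ c * (n * γ + ν₂ * ((2 * β - 1) * n + 2)) := by
    gcongr
    linarith
  calc _ ≤ Real.exp (-(c ^ 2 * n / 2)) * ((J + 1) * Real.exp (n * (c * (Isph c α + κ / 2))) *
          (Real.exp (c * (n * γ + ν₂ * ((2 * β - 1) * n + 2))) *
            Real.exp (n * (c * (v - ν₂ * (2 * β - 1) - γ))))) := by
        gcongr
    _ = M * Real.exp (-(2 * ε) * n) := by
        have : Real.exp (-(c ^ 2 * n / 2)) * Real.exp (n * (c * (Isph c α + κ / 2))) *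
            Real.exp (c * (n * γ + ν₂ * ((2 * β - 1) * n + 2))) *
            Real.exp (n * (c * (v - ν₂ * (2 * β - 1) - γ)))
            = Real.exp (2 * c * ν₂) * Real.exp (-(2 * ε) * n) := by
          rw [← Real.exp_add, ← Real.exp_add, ← Real.exp_add, ← Real.exp_add]
          congr 1
          rw [hε, hκ]
          ring
        rw [hM]
        linear_combination ((J:ℝ) + 1) * this
    _ ≤ Real.exp (ε * n) * Real.exp (-(2 * ε) * n) := by gcongr
    _ = Real.exp (-ε * n) := by rw [← Real.exp_add]; congr 1; ring

end GI

theorem strong_threshold_nonnegative_lifted_lower_bound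
    (α β : ℝ) (hα : α ∈ Set.Ioo (0 : ℝ) 1) (hβ : β ∈ Set.Ioo (0 : ℝ) 1)
    (hcond : ∃ c : ℝ, 0 < c ∧ -c / 2 + IstrPlus c β + Isph c α < 0) :
    ∃ ε > (0 : ℝ), ∃ N : ℕ, ∀ n ≥ N,
      1 - ENNReal.ofReal (Real.exp (-ε * n)) ≤
        matrixGaussian (⌈α * n⌉₊) n
          {A | ∀ x : Fin n → ℝ, (∀ i, 0 ≤ x i) →
            (∃ K : Finset (Fin n), K.card ≤ ⌈β * n⌉₊ ∧ ∀ i ∉ K, x i = 0) →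
              UniqueL1MinNonneg A x} := by
  obtain ⟨ε, hε, N, h⟩ := GI.main_aux α β hα hβ hcond
  refine ⟨ε, hε, N, fun n hn => ?_⟩
  have hb := h n hn
  have mp := GI.mp_uncurry ⌈α * n⌉₊ n
  rw [← mp.map_eq] at hb
  have hb2 := (Measure.le_map_apply mp.measurable.aemeasurable _).trans hb
  rw [tsub_le_iff_right]
  have hu : (1 : ENNReal) = matrixGaussian ⌈α * n⌉₊ n Set.univ := by
    unfold matrixGaussian
    rw [measure_univ]
  rw [hu]
  refine le_trans ?_ (add_le_add_right hb2 _)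
  refine le_trans (measure_mono ?_) (measure_union_le _ _)
  intro A _
  by_cases hA : ∃ w ∈ GI.Scone n ⌈β * n⌉₊, ∀ i, ∑ j, A i j * w j = 0
  · exact Or.inr hA
  · exact Or.inl fun x hx hK => GI.bad_subset A hA x hx hK
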